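/- Suppose n ≥ 4 and p satisfies condition (A) at a with exponent k > 2 and coefficient β_k > 0. Then for every λ > 0, S_λ(p) < p₀·S. -/

import Mathlib

open MeasureTheory Filter Asymptotics
open scoped Topology

noncomputable section

/-- Euclidean space `ℝⁿ`. -/
abbrev Euc (n : ℕ) := EuclideanSpace ℝ (Fin n)

/-- `u ∈ C_c^∞(Ω)`, `u ≢ 0`. -/
def IsTest {n : ℕ} (Ω : Set (Euc n)) (u : Euc n → ℝ) : Prop :=
  ContDiff ℝ (⊤ : ℕ∞) u ∧ HasCompactSupport u ∧ tsupport u ⊆ Ω ∧ u ≠ 0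

/-- Condition (A): `lim_{x→a} (p(x) - p₀)/|x-a|^k = β`. -/
def CondA {n : ℕ} (p : Euc n → ℝ) (a : Euc n) (p₀ k β : ℝ) : Prop :=
  Tendsto (fun x => (p x - p₀) / ‖x - a‖ ^ k) (𝓝[≠] a) (𝓝 β)

/-- The best Sobolev constant
`S = inf { ∫_Ω |∇u|² / (∫_Ω |u|^q)^{2/q} : u ∈ C_c^∞(Ω), u ≢ 0 }`. -/
def SobolevS {n : ℕ} (Ω : Set (Euc n)) (q : ℝ) : ℝ :=
  sInf {r : ℝ | ∃ u : Euc n → ℝ, IsTest Ω u ∧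
    r = (∫ x in Ω, ‖gradient u x‖ ^ 2) / (∫ x in Ω, |u x| ^ q) ^ (2 / q)}

/-- `S_λ(p) = inf { (∫_Ω p|∇u|² - λ∫_Ω u²) / (∫_Ω |u|^q)^{2/q} : u ∈ C_c^∞(Ω), u ≢ 0 }`. -/
def Slam {n : ℕ} (Ω : Set (Euc n)) (p : Euc n → ℝ) (q lam : ℝ) : ℝ :=
  sInf {r : ℝ | ∃ u : Euc n → ℝ, IsTest Ω u ∧
    r = ((∫ x in Ω, p x * ‖gradient u x‖ ^ 2) - lam * ∫ x in Ω, (u x) ^ 2) /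
        (∫ x in Ω, |u x| ^ q) ^ (2 / q)}

open scoped ENNReal Pointwise

/-- One-dimensional Brunn–Minkowski inequality for `A + t B`. -/
lemma volume_add_mul_volume_le {A B C : Set ℝ} (hA : MeasurableSet A) (hB : MeasurableSet B)
    (hAn : A.Nonempty) (hBn : B.Nonempty) {t : ℝ} (ht : 0 < t)
    (h : ∀ x ∈ A, ∀ y ∈ B, x + t * y ∈ C) :
    volume A + ENNReal.ofReal t * volume B ≤ volume C := by
  have key : ∀ K L : Set ℝ, IsCompact K → IsCompact L → K ⊆ A → L ⊆ B → K.Nonempty → L.Nonempty →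
      volume K + ENNReal.ofReal t * volume L ≤ volume C := by
    intro K L hK hL hKA hLB hKn hLn
    obtain ⟨M, hMK, hM⟩ := hK.exists_isGreatest hKn
    obtain ⟨l, hlL, hl⟩ := hL.exists_isLeast hLn
    have hS1 : volume ((fun x => x + t * l) '' K) = volume K := by
      rw [Set.image_add_right, measure_preimage_add_right]
    have hS2 : volume ((fun x => M + x) '' (t • L)) = ENNReal.ofReal t * volume L := by
      rw [Set.image_add_left, measure_preimage_add, Measure.addHaar_smul]
      simp [abs_of_pos ht]
    rw [← hS1, ← hS2, ← measure_union₀]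
    · apply measure_mono
      rintro z (⟨x, hx, rfl⟩ | ⟨x, ⟨y, hy, rfl⟩, rfl⟩)
      · exact h x (hKA hx) l (hLB hlL)
      · exact h M (hKA hMK) y (hLB hy)
    · exact (((hL.smul t).image (continuous_const.add continuous_id)).measurableSet).nullMeasurableSet
    · refine measure_mono_null (t := {M + t * l}) ?_ (by simp)
      rintro z ⟨⟨x, hx, rfl⟩, ⟨x', ⟨y, hy, rfl⟩, hxy⟩⟩
      have h1 := hM hx
      have h2 := mul_le_mul_of_nonneg_left (hl hy) ht.le
      simp only [smul_eq_mul] at hxy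
      simp only [Set.mem_singleton_iff]
      linarith
  obtain ⟨a, ha⟩ := hAn
  obtain ⟨b, hb⟩ := hBn
  have key2 : ∀ K L : Set ℝ, IsCompact K → IsCompact L → K ⊆ A → L ⊆ B →
      volume K + ENNReal.ofReal t * volume L ≤ volume C := by
    intro K L hK hL hKA hLB
    refine le_trans ?_ (key (insert a K) (insert b L) (hK.insert a) (hL.insert b)
      (Set.insert_subset ha hKA) (Set.insert_subset hb hLB) (by simp) (by simp))
    gcongr <;> exact Set.subset_insert _ _
  rw [hA.measure_eq_iSup_isCompact, hB.measure_eq_iSup_isCompact]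
  have : ∀ L : Set ℝ, IsCompact L → L ⊆ B →
      (⨆ K, ⨆ (_ : K ⊆ A), ⨆ (_ : IsCompact K), volume K) + ENNReal.ofReal t * volume L
        ≤ volume C := by
    intro L hL hLB
    have hfin : ENNReal.ofReal t * volume L ≠ ∞ :=
      ENNReal.mul_ne_top ENNReal.ofReal_ne_top hL.measure_lt_top.ne
    have h0 : ENNReal.ofReal t * volume L ≤ volume C := by
      simpa using key2 ∅ L isCompact_empty hL (by simp) hLB
    rw [← tsub_add_cancel_of_le h0]
    gcongr
    refine iSup_le fun K => iSup_le fun hKA => iSup_le fun hK => ?_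
    exact ENNReal.le_sub_of_add_le_right hfin (key2 K L hK hL hKA hLB)
  set X := (⨆ K, ⨆ (_ : K ⊆ A), ⨆ (_ : IsCompact K), volume K)
  by_cases hX : X = ∞
  · have := this ∅ isCompact_empty (by simp)
    simp only [hX, measure_empty, mul_zero, add_zero, top_le_iff] at this
    simp [this]
  have h0 : X ≤ volume C := by simpa using this ∅ isCompact_empty (by simp)
  rw [← add_tsub_cancel_of_le h0]
  gcongr
  simp only [ENNReal.mul_iSup]
  refine iSup_le fun L => iSup_le fun hLB => iSup_le fun hL => ?_
  exact ENNReal.le_sub_of_add_le_left hX (this L hL hLB)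

lemma lintegral_eq_lintegral_measure_lt {α : Type*} [MeasurableSpace α] (μ : Measure α)
    [SFinite μ] {u : α → ℝ≥0∞} (hu : Measurable u) :
    ∫⁻ x, u x ∂μ = ∫⁻ s in Set.Ioi (0 : ℝ), μ {x | ENNReal.ofReal s < u x} := by
  have h1 : ∀ c : ℝ≥0∞, c = ∫⁻ s in Set.Ioi (0 : ℝ),
      {s : ℝ | ENNReal.ofReal s < c}.indicator 1 s := by
    intro c
    rw [lintegral_indicator_one (measurableSet_lt (by fun_prop) measurable_const),
      Measure.restrict_apply (measurableSet_lt (by fun_prop) measurable_const)]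
    by_cases hc : c = ∞
    · subst hc
      simp
    · have : {s : ℝ | ENNReal.ofReal s < c} ∩ Set.Ioi 0 = Set.Ioo 0 c.toReal := by
        ext s
        simp only [Set.mem_inter_iff, Set.mem_ofPred_eq, Set.mem_Ioi, Set.mem_Ioo]
        constructor
        · rintro ⟨h, hs⟩
          exact ⟨hs, (ENNReal.ofReal_lt_iff_lt_toReal hs.le hc).1 h⟩
        · rintro ⟨hs, h⟩
          exact ⟨(ENNReal.ofReal_lt_iff_lt_toReal hs.le hc).2 h, hs⟩
      rw [this]
      simp [ENNReal.ofReal_toReal hc]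
  calc ∫⁻ x, u x ∂μ = ∫⁻ x, (∫⁻ s in Set.Ioi (0 : ℝ),
        {s : ℝ | ENNReal.ofReal s < u x}.indicator (1 : ℝ → ℝ≥0∞) s) ∂μ :=
        lintegral_congr fun x => h1 _
    _ = ∫⁻ s in Set.Ioi (0 : ℝ), ∫⁻ x,
        {s : ℝ | ENNReal.ofReal s < u x}.indicator (1 : ℝ → ℝ≥0∞) s ∂μ := by
        apply lintegral_lintegral_swap
        have : (Function.uncurry fun (x : α) (s : ℝ) =>
            {s : ℝ | ENNReal.ofReal s < u x}.indicator (1 : ℝ → ℝ≥0∞) s) =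
            {p : α × ℝ | ENNReal.ofReal p.2 < u p.1}.indicator 1 := by
          ext ⟨x, s⟩
          simp [Set.indicator_apply]
        rw [this]
        refine (measurable_one.indicator (measurableSet_lt ?_ ?_)).aemeasurable
        · fun_prop
        · fun_prop
    _ = _ := by
        refine lintegral_congr fun s => ?_
        rw [← lintegral_indicator_one (measurableSet_lt measurable_const hu)]
        refine lintegral_congr fun x => ?_
        simp [Set.indicator_apply]

/-- If the suprema agree, a `min`-type lower bound along `x + t y` makes integrals superadditive. -/
lemma lintegral_add_le_of_min_le {U V W : ℝ → ℝ≥0∞} (hU : Measurable U) (hV : Measurable V)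
    (hW : Measurable W) {t : ℝ} (ht : 0 < t) (h : ∀ x y, min (U x) (V y) ≤ W (x + t * y))
    (hs : ⨆ x, U x = ⨆ x, V x) :
    (∫⁻ x, U x) + ENNReal.ofReal t * ∫⁻ x, V x ≤ ∫⁻ x, W x := by
  rw [lintegral_eq_lintegral_measure_lt _ hU, lintegral_eq_lintegral_measure_lt _ hV,
    lintegral_eq_lintegral_measure_lt _ hW, ← lintegral_const_mul' _ _ ENNReal.ofReal_ne_top]
  refine (le_lintegral_add _ _).trans (lintegral_mono fun s => ?_)
  by_cases hsU : ENNReal.ofReal s < ⨆ x, U x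
  · refine volume_add_mul_volume_le (measurableSet_lt measurable_const hU)
      (measurableSet_lt measurable_const hV) ?_ ?_ ht ?_
    · exact lt_iSup_iff.1 hsU
    · rw [hs] at hsU
      exact lt_iSup_iff.1 hsU
    · intro x hx y hy
      exact lt_of_lt_of_le (lt_min hx hy) (h x y)
  · have h1 : {x | ENNReal.ofReal s < U x} = ∅ := by
      ext x
      simpa using (le_iSup U x).trans (not_lt.1 hsU)
    have h2 : {x | ENNReal.ofReal s < V x} = ∅ := by
      ext x
      rw [hs] at hsU
      simpa using (le_iSup V x).trans (not_lt.1 hsU)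
    simp [h1, h2]

/-- The one-dimensional Borell–Brascamp–Lieb step before optimising over the levels `a`, `b`. -/
lemma exists_rpow_mul_lintegral_le {F G H : ℝ → ℝ≥0∞} (hF : Measurable F) (hG : Measurable G)
    (hH : Measurable H) {t : ℝ} (ht : 0 < t)
    (h : ∀ x y, H (x + t * y) ≤ F x + ENNReal.ofReal t * G y)
    {c : ℝ≥0∞} (hc : c ≠ 0) (hcF : ∀ x, c ≤ F x) (hcG : ∀ x, c ≤ G x)
    (hF' : ∃ x, F x ≠ ∞) (hG' : ∃ x, G x ≠ ∞) {m : ℝ} (hm : 0 < m) :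
    ∃ a b : ℝ≥0∞, a ≠ 0 ∧ b ≠ 0 ∧ a ≠ ∞ ∧ b ≠ ∞ ∧
      a ^ m * (∫⁻ x, F x ^ (-m)) + ENNReal.ofReal t * (b ^ m * ∫⁻ x, G x ^ (-m)) ≤
        (a + ENNReal.ofReal t * b) ^ m * ∫⁻ x, H x ^ (-m) := by
  have hpos : ∀ K : ℝ → ℝ≥0∞, (∀ x, c ≤ K x) → (⨅ x, K x) ≠ 0 := fun K hK h0 =>
    hc (le_antisymm (h0 ▸ le_iInf hK) zero_le)
  have hfin : ∀ K : ℝ → ℝ≥0∞, (∃ x, K x ≠ ∞) → (⨅ x, K x) ≠ ∞ := by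
    rintro K ⟨x, hx⟩ h0
    exact hx (top_le_iff.1 (h0 ▸ iInf_le K x))
  set a := ⨅ x, F x with ha
  set b := ⨅ x, G x with hb
  have ha0 : a ≠ 0 := hpos F hcF
  have hb0 : b ≠ 0 := hpos G hcG
  have ha1 : a ≠ ∞ := hfin F hF'
  have hb1 : b ≠ ∞ := hfin G hG'
  refine ⟨a, b, ha0, hb0, ha1, hb1, ?_⟩
  have hsup : ∀ K : ℝ → ℝ≥0∞, (⨅ x, K x) ≠ 0 → (⨅ x, K x) ≠ ∞ →
      ⨆ x, ((⨅ x, K x) * (K x)⁻¹) ^ m = 1 := by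
    intro K h0 h1
    have := (ENNReal.orderIsoRpow m hm).map_iSup (fun x => (⨅ x, K x) * (K x)⁻¹)
    simp only [ENNReal.orderIsoRpow_apply] at this
    rw [← this, ← ENNReal.mul_iSup, ← ENNReal.inv_iInf, ENNReal.mul_inv_cancel h0 h1,
      ENNReal.one_rpow]
  have e1 : ∀ (r : ℝ≥0∞) (K : ℝ → ℝ≥0∞), r ≠ ∞ →
      ∫⁻ x, (r * (K x)⁻¹) ^ m = r ^ m * ∫⁻ x, K x ^ (-m) := by
    intro r K hr
    rw [← lintegral_const_mul' _ _ (ENNReal.rpow_ne_top_of_nonneg hm.le hr)]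
    refine lintegral_congr fun x => ?_
    rw [ENNReal.mul_rpow_of_nonneg _ _ hm.le, ENNReal.inv_rpow, ENNReal.rpow_neg]
  have htb : ENNReal.ofReal t * b ≠ ∞ := ENNReal.mul_ne_top ENNReal.ofReal_ne_top hb1
  have hab : a + ENNReal.ofReal t * b ≠ ∞ := ENNReal.add_ne_top.2 ⟨ha1, htb⟩
  have hab0 : a + ENNReal.ofReal t * b ≠ 0 := by simp [ha0]
  rw [← e1 a F ha1, ← e1 b G hb1, ← e1 _ H hab]
  refine lintegral_add_le_of_min_le ?_ ?_ ?_ ht ?_ ?_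
  · fun_prop
  · fun_prop
  · fun_prop
  · intro x y
    rw [← (ENNReal.monotone_rpow_of_nonneg hm.le).map_min]
    refine ENNReal.rpow_le_rpow ?_ hm.le
    set μ := min (a * (F x)⁻¹) (b * (G y)⁻¹)
    have h1 : μ * F x ≤ a := ENNReal.mul_le_of_le_div (min_le_left _ _)
    have h2 : μ * G y ≤ b := ENNReal.mul_le_of_le_div (min_le_right _ _)
    rw [← div_eq_mul_inv, ENNReal.le_div_iff_mul_le (Or.inr hab0) (Or.inr hab)]
    calc μ * H (x + t * y) ≤ μ * (F x + ENNReal.ofReal t * G y) := by gcongr; exact h x y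
      _ = μ * F x + ENNReal.ofReal t * (μ * G y) := by ring
      _ ≤ _ := by gcongr
  · rw [hsup F ha0 ha1, hsup G hb0 hb1]

/-- Reduction of an inequality for positive functions to functions bounded away from zero. -/
lemma tendsto_lintegral_add_inv_rpow {F : ℝ → ℝ≥0∞} (hF : Measurable F) {m : ℝ} (hm : 0 < m) :
    Tendsto (fun k : ℕ => ∫⁻ x, (F x + (k + 1 : ℝ≥0∞)⁻¹) ^ (-m)) atTop
      (𝓝 (∫⁻ x, F x ^ (-m))) := by
  refine lintegral_tendsto_of_tendsto_of_monotone (fun k => ?_) ?_ ?_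
  · fun_prop
  · refine Eventually.of_forall fun x i j hij => ?_
    simp only [ENNReal.rpow_neg]
    gcongr
  · refine Eventually.of_forall fun x => ?_
    refine (ENNReal.continuous_rpow_const.tendsto (F x)).comp ?_
    have h1 : Tendsto (fun k : ℕ => ((k + 1 : ℕ) : ℝ≥0∞)⁻¹) atTop (𝓝 0) :=
      ENNReal.tendsto_inv_nat_nhds_zero.comp (tendsto_add_atTop_nat 1)
    simpa using (tendsto_const_nhds (x := F x)).add h1

lemma lintegral_rpow_step {F G H : ℝ → ℝ≥0∞} (hF : Measurable F) (hG : Measurable G)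
    (hH : Measurable H) {t : ℝ} (ht : 0 < t)
    (h : ∀ x y, H (x + t * y) ≤ F x + ENNReal.ofReal t * G y) {m : ℝ} (hm : 1 < m) :
    (∫⁻ x, H x ^ (-m)) ^ (-1 / (m - 1)) ≤ (∫⁻ x, F x ^ (-m)) ^ (-1 / (m - 1)) +
      ENNReal.ofReal t * (∫⁻ x, G x ^ (-m)) ^ (-1 / (m - 1)) := by
  have hm0 : 0 < m := by linarith
  have hm1 : 0 < m - 1 := by linarith
  have key : ∀ F G : ℝ → ℝ≥0∞, Measurable F → Measurable G →
      (∀ x y, H (x + t * y) ≤ F x + ENNReal.ofReal t * G y) →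
      (∃ c : ℝ≥0∞, c ≠ 0 ∧ (∀ x, c ≤ F x) ∧ ∀ x, c ≤ G x) →
      (∫⁻ x, H x ^ (-m)) ^ (-1 / (m - 1)) ≤ (∫⁻ x, F x ^ (-m)) ^ (-1 / (m - 1)) +
      ENNReal.ofReal t * (∫⁻ x, G x ^ (-m)) ^ (-1 / (m - 1)) := by
    rintro F G hF hG h ⟨c, hc, hcF, hcG⟩
    have htriv : ∀ K : ℝ → ℝ≥0∞, (¬ ∃ x, K x ≠ ∞) →
        (∫⁻ x, K x ^ (-m)) ^ (-1 / (m - 1)) = ∞ := by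
      intro K hK
      push Not at hK
      have : -1 / (m - 1) < 0 := div_neg_of_neg_of_pos (by norm_num) hm1
      simp [hK, hm0, this]
    have ht0 : ENNReal.ofReal t ≠ 0 := by simpa using ht
    by_cases hF' : ∃ x, F x ≠ ∞
    swap
    · rw [htriv F hF']; simp
    by_cases hG' : ∃ x, G x ≠ ∞
    swap
    · rw [htriv G hG', ENNReal.mul_top ht0]; simp
    obtain ⟨a, b, ha0, hb0, ha1, hb1, hab⟩ :=
      exists_rpow_mul_lintegral_le hF hG hH ht h hc hcF hcG hF' hG' hm0
    have hinv : ∀ X : ℝ≥0∞, X = (X ^ (-1 / (m - 1))) ^ (1 - m) := by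
      intro X
      rw [← ENNReal.rpow_mul]
      have : -1 / (m - 1) * (1 - m) = 1 := by field_simp; ring
      rw [this, ENNReal.rpow_one]
    rw [hinv (∫⁻ x, F x ^ (-m)), hinv (∫⁻ x, G x ^ (-m)), hinv (∫⁻ x, H x ^ (-m))] at hab
    generalize (∫⁻ x, F x ^ (-m)) ^ (-1 / (m - 1)) = ξ at hab ⊢
    generalize (∫⁻ x, G x ^ (-m)) ^ (-1 / (m - 1)) = η at hab ⊢
    generalize (∫⁻ x, H x ^ (-m)) ^ (-1 / (m - 1)) = ζ at hab ⊢
    set τ := ENNReal.ofReal t with hτ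
    have hτ1 : τ ≠ ∞ := ENNReal.ofReal_ne_top
    have habt : (a + τ * b) ^ m ≠ ∞ := by
      refine ENNReal.rpow_ne_top_of_nonneg hm0.le (ENNReal.add_ne_top.2 ⟨ha1, ?_⟩)
      exact ENNReal.mul_ne_top hτ1 hb1
    have hpow0 : ∀ r : ℝ≥0∞, r ≠ 0 → r ^ m ≠ 0 := by
      intro r hr
      simp [hr, hm0, ENNReal.rpow_eq_zero_iff, not_lt.2 hm0.le]
    have hneg : 1 - m < 0 := by linarith
    have hζ : (a + τ * b) ^ m * ζ ^ (1 - m) = ∞ → ζ = 0 := by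
      intro h
      have := (ENNReal.mul_eq_top.1 h)
      rcases this with ⟨_, h⟩ | ⟨h, _⟩
      · simpa [ENNReal.rpow_eq_top_iff, hneg, not_lt.2 hneg.le] using h
      · exact absurd h habt
    by_cases hξ0 : ξ = 0
    · rw [hξ0, ENNReal.zero_rpow_of_neg hneg, ENNReal.mul_top (hpow0 a ha0), top_add,
        top_le_iff] at hab
      simp [hζ hab]
    by_cases hη0 : η = 0
    · rw [hη0, ENNReal.zero_rpow_of_neg hneg, ENNReal.mul_top (hpow0 b hb0),
        ENNReal.mul_top ht0, add_top, top_le_iff] at hab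
      simp [hζ hab]
    by_cases hξ1 : ξ = ∞
    · simp [hξ1]
    by_cases hη1 : η = ∞
    · simp [hη1, ENNReal.mul_top ht0]
    have hσ1 : ξ + τ * η ≠ ∞ := ENNReal.add_ne_top.2 ⟨hξ1, ENNReal.mul_ne_top hτ1 hη1⟩
    have hσ0 : ξ + τ * η ≠ 0 := by simp [hξ0]
    set σ := ξ + τ * η with hσ
    have hσi0 : σ⁻¹ ≠ 0 := ENNReal.inv_ne_zero.2 hσ1
    have hσi1 : σ⁻¹ ≠ ∞ := ENNReal.inv_ne_top.2 hσ0
    have conv := ENNReal.rpow_arith_mean_le_arith_mean2_rpow (ξ * σ⁻¹) (τ * η * σ⁻¹) (a * ξ⁻¹)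
      (b * η⁻¹) (by rw [← add_mul, ENNReal.mul_inv_cancel hσ0 hσ1]) hm.le
    have e0 : ξ * σ⁻¹ * (a * ξ⁻¹) + τ * η * σ⁻¹ * (b * η⁻¹) = (a + τ * b) * σ⁻¹ := by
      calc _ = (ξ * ξ⁻¹) * a * σ⁻¹ + (η * η⁻¹) * τ * b * σ⁻¹ := by ring
        _ = _ := by
          rw [ENNReal.mul_inv_cancel hξ0 hξ1, ENNReal.mul_inv_cancel hη0 hη1]; ring
    have hp : ∀ r s : ℝ≥0∞, s ≠ 0 → s ≠ ∞ → s * (r * s⁻¹) ^ m = r ^ m * s ^ (1 - m) := by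
      intro r s hs0 hs1
      rw [ENNReal.mul_rpow_of_nonneg _ _ hm0.le, ENNReal.inv_rpow, ← ENNReal.rpow_neg,
        sub_eq_add_neg, ENNReal.rpow_add _ _ hs0 hs1, ENNReal.rpow_one]
      ring
    have e2 : (a + τ * b) ^ m * σ ^ (1 - m) ≤ (a + τ * b) ^ m * ζ ^ (1 - m) := by
      refine le_trans ?_ hab
      rw [← hp _ σ hσ0 hσ1, ← hp a ξ hξ0 hξ1, ← hp b η hη0 hη1, ← e0]
      calc _ ≤ σ * (ξ * σ⁻¹ * (a * ξ⁻¹) ^ m + τ * η * σ⁻¹ * (b * η⁻¹) ^ m) := by gcongr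
        _ = (σ * σ⁻¹) * (ξ * (a * ξ⁻¹) ^ m + τ * (η * (b * η⁻¹) ^ m)) := by ring
        _ = _ := by rw [ENNReal.mul_inv_cancel hσ0 hσ1, one_mul]
    have e3 : σ ^ (1 - m) ≤ ζ ^ (1 - m) :=
      (ENNReal.mul_le_mul_iff_right (hpow0 _ (by simp [ha0])) habt).1 e2
    have e4 : 1 - m = -(m - 1) := by ring
    rw [e4, ENNReal.rpow_neg, ENNReal.rpow_neg, ENNReal.inv_le_inv] at e3
    exact (ENNReal.rpow_le_rpow_iff hm1).1 e3
  have hlim := fun (K : ℝ → ℝ≥0∞) (hK : Measurable K) =>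
    (ENNReal.continuous_rpow_const (y := -1 / (m - 1))).continuousAt.tendsto.comp
      (tendsto_lintegral_add_inv_rpow hK hm0)
  refine le_of_tendsto_of_tendsto' tendsto_const_nhds ((hlim F hF).add
    (ENNReal.Tendsto.const_mul (hlim G hG) (Or.inr ENNReal.ofReal_ne_top))) fun k => ?_
  refine key _ _ (by fun_prop) (by fun_prop) (fun x y => (h x y).trans ?_)
    ⟨(k + 1 : ℝ≥0∞)⁻¹, ?_, ?_, ?_⟩
  · gcongr <;> simp
  · exact ENNReal.inv_ne_zero.2 (by finiteness)
  · simp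
  · simp

lemma min_lintegral_inv_le {F G H : ℝ → ℝ≥0∞} (hF : Measurable F) (hG : Measurable G)
    (hH : Measurable H) {t : ℝ} (ht : 0 < t)
    (h : ∀ x y, H (x + t * y) ≤ F x + ENNReal.ofReal t * G y) :
    min (∫⁻ x, F x ^ (-1 : ℝ)) (∫⁻ x, G x ^ (-1 : ℝ)) ≤ ∫⁻ x, H x ^ (-1 : ℝ) := by
  have key : ∀ F G : ℝ → ℝ≥0∞, Measurable F → Measurable G →
      (∀ x y, H (x + t * y) ≤ F x + ENNReal.ofReal t * G y) →
      (∃ c : ℝ≥0∞, c ≠ 0 ∧ (∀ x, c ≤ F x) ∧ ∀ x, c ≤ G x) →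
      min (∫⁻ x, F x ^ (-1 : ℝ)) (∫⁻ x, G x ^ (-1 : ℝ)) ≤ ∫⁻ x, H x ^ (-1 : ℝ) := by
    rintro F G hF hG h ⟨c, hc, hcF, hcG⟩
    by_cases hF' : ∃ x, F x ≠ ∞
    swap
    · push Not at hF'; simp [hF']
    by_cases hG' : ∃ x, G x ≠ ∞
    swap
    · push Not at hG'; simp [hG']
    obtain ⟨a, b, ha0, hb0, ha1, hb1, hab⟩ :=
      exists_rpow_mul_lintegral_le hF hG hH ht h hc hcF hcG hF' hG' one_pos
    simp only [ENNReal.rpow_one] at hab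
    have h0 : a + ENNReal.ofReal t * b ≠ 0 := by simp [ha0]
    have h1 : a + ENNReal.ofReal t * b ≠ ∞ :=
      ENNReal.add_ne_top.2 ⟨ha1, ENNReal.mul_ne_top ENNReal.ofReal_ne_top hb1⟩
    refine (ENNReal.mul_le_mul_iff_right h0 h1).1 (le_trans ?_ hab)
    rw [add_mul, mul_assoc]
    gcongr
    · exact min_le_left _ _
    · exact min_le_right _ _
  have hlim := fun (K : ℝ → ℝ≥0∞) (hK : Measurable K) =>
    tendsto_lintegral_add_inv_rpow hK one_pos
  refine le_of_tendsto' ((hlim F hF).min (hlim G hG)) fun k => ?_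
  refine key _ _ (by fun_prop) (by fun_prop) (fun x y => (h x y).trans ?_)
    ⟨(k + 1 : ℝ≥0∞)⁻¹, ?_, ?_, ?_⟩
  · gcongr <;> simp
  · exact ENNReal.inv_ne_zero.2 (by finiteness)
  · simp
  · simp

lemma measurePreserving_finCons (d : ℕ) :
    MeasurePreserving (fun p : ℝ × (Fin d → ℝ) => (Fin.cons p.1 p.2 : Fin (d + 1) → ℝ)) := by
  have h := (volume_preserving_piFinSuccAbove (fun _ : Fin (d + 1) => ℝ) 0).symm
  have e : (fun p : ℝ × (Fin d → ℝ) => (Fin.cons p.1 p.2 : Fin (d + 1) → ℝ)) =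
      (MeasurableEquiv.piFinSuccAbove (fun _ : Fin (d + 1) => ℝ) 0).symm := by
    ext p : 1
    simp [MeasurableEquiv.piFinSuccAbove, Fin.insertNthEquiv]
  rw [e]
  exact h

lemma lintegral_fin_succ {d : ℕ} {F : (Fin (d + 1) → ℝ) → ℝ≥0∞} (hF : Measurable F) :
    ∫⁻ x, F x = ∫⁻ s, ∫⁻ y, F (Fin.cons s y) := by
  rw [← (measurePreserving_finCons d).lintegral_comp hF]
  exact lintegral_prod _ (hF.comp (measurePreserving_finCons d).measurable).aemeasurable

lemma lintegral_fin_succ_symm {d : ℕ} {F : (Fin (d + 1) → ℝ) → ℝ≥0∞} (hF : Measurable F) :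
    ∫⁻ x, F x = ∫⁻ y, ∫⁻ s, F (Fin.cons s y) := by
  rw [← (measurePreserving_finCons d).lintegral_comp hF]
  exact lintegral_prod_symm _ (hF.comp (measurePreserving_finCons d).measurable).aemeasurable

lemma finCons_add_smul {d : ℕ} (s₁ s₂ t : ℝ) (y₁ y₂ : Fin d → ℝ) :
    (Fin.cons (s₁ + t * s₂) (y₁ + t • y₂) : Fin (d + 1) → ℝ) =
      Fin.cons s₁ y₁ + t • (Fin.cons s₂ y₂ : Fin (d + 1) → ℝ) := by
  ext i
  refine Fin.cases ?_ (fun j => ?_) i <;> simp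

lemma measurable_comp_finCons {d : ℕ} {F : (Fin (d + 1) → ℝ) → ℝ≥0∞} (hF : Measurable F) :
    Measurable fun p : ℝ × (Fin d → ℝ) => F (Fin.cons p.1 p.2) :=
  hF.comp (measurePreserving_finCons d).measurable

/-- Borell–Brascamp–Lieb inequality at the critical exponent. -/
lemma min_lintegral_rpow_neg_le {t : ℝ} (ht : 0 < t) (d : ℕ) :
    ∀ F G H : (Fin (d + 1) → ℝ) → ℝ≥0∞, Measurable F → Measurable G → Measurable H →
      (∀ x y, H (x + t • y) ≤ F x + ENNReal.ofReal t * G y) →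
      min (∫⁻ x, F x ^ (-(d + 1 : ℝ))) (∫⁻ x, G x ^ (-(d + 1 : ℝ))) ≤
        ∫⁻ x, H x ^ (-(d + 1 : ℝ)) := by
  induction d with
  | zero =>
    intro F G H hF hG hH h
    rw [lintegral_fin_succ (by fun_prop), lintegral_fin_succ (by fun_prop),
      lintegral_fin_succ (by fun_prop)]
    simp only [CharP.cast_eq_zero, zero_add, lintegral_unique, volume_pi, Measure.pi_univ,
      Finset.univ_eq_empty, Finset.prod_empty, mul_one]
    have hm : ∀ (K : (Fin 1 → ℝ) → ℝ≥0∞) (y : Fin 0 → ℝ), Measurable K →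
        Measurable fun s : ℝ => K (Fin.cons s y) := fun K y hK =>
      (measurable_comp_finCons hK).comp (measurable_id.prodMk measurable_const)
    refine min_lintegral_inv_le (hm F _ hF) (hm G _ hG) (hm H _ hH) ht fun x y => ?_
    have := fun z : Fin 0 → ℝ => h (Fin.cons x z) (Fin.cons y z)
    simp only [← finCons_add_smul] at this
    convert this default
  | succ d ih =>
    intro F G H hF hG hH h
    set m : ℝ := ((d + 1 : ℕ) : ℝ) + 1 with hm
    have hm1 : m - 1 = d + 1 := by simp [hm]
    have hm1' : 1 < m := by rw [hm]; push_cast; linarith [Nat.cast_nonneg (α := ℝ) d]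
    have hslice : ∀ K : (Fin (d + 1 + 1) → ℝ) → ℝ≥0∞, Measurable K →
        Measurable fun y : Fin (d + 1) → ℝ => ∫⁻ s, K (Fin.cons s y) ^ (-m) := by
      intro K hK
      have : Measurable fun p : ℝ × (Fin (d + 1) → ℝ) => K (Fin.cons p.1 p.2) ^ (-m) :=
        (measurable_comp_finCons hK).pow_const _
      exact this.lintegral_prod_left'
    have hpow : ∀ X : ℝ≥0∞, (X ^ (-1 / (m - 1))) ^ (-(d + 1 : ℝ)) = X := by
      intro X
      rw [← ENNReal.rpow_mul, hm1]
      have : -1 / ((d : ℝ) + 1) * -(d + 1) = 1 := by field_simp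
      rw [this, ENNReal.rpow_one]
    have key := ih (fun y => (∫⁻ s, F (Fin.cons s y) ^ (-m)) ^ (-1 / (m - 1)))
      (fun y => (∫⁻ s, G (Fin.cons s y) ^ (-m)) ^ (-1 / (m - 1)))
      (fun y => (∫⁻ s, H (Fin.cons s y) ^ (-m)) ^ (-1 / (m - 1)))
      ((hslice F hF).pow_const _) ((hslice G hG).pow_const _) ((hslice H hH).pow_const _) ?_
    · simp only [hpow] at key
      rwa [lintegral_fin_succ_symm (hF.pow_const _), lintegral_fin_succ_symm (hG.pow_const _),
        lintegral_fin_succ_symm (hH.pow_const _)]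
    · intro y₁ y₂
      have hms : ∀ (K : (Fin (d + 1 + 1) → ℝ) → ℝ≥0∞) (y : Fin (d + 1) → ℝ), Measurable K →
          Measurable fun s : ℝ => K (Fin.cons s y) := fun K y hK =>
        (measurable_comp_finCons hK).comp (measurable_id.prodMk measurable_const)
      refine lintegral_rpow_step (hms F _ hF) (hms G _ hG) (hms H _ hH) ht (fun s₁ s₂ => ?_) hm1'
      rw [finCons_add_smul]
      exact h _ _

/-- Bobkov–Ledoux form of the Borell–Brascamp–Lieb inequality for functions whose largest
hyperplane sections agree. -/
lemma lintegral_rpow_neg_add_le {t : ℝ} (ht : 0 < t) {d : ℕ} (hd : 1 ≤ d)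
    {F G H : (Fin (d + 1) → ℝ) → ℝ≥0∞} (hF : Measurable F) (hG : Measurable G)
    (hH : Measurable H) (h : ∀ x y, H (x + t • y) ≤ F x + ENNReal.ofReal t * G y)
    (hs : ⨆ s, ∫⁻ y, F (Fin.cons s y) ^ (-(d : ℝ)) = ⨆ s, ∫⁻ y, G (Fin.cons s y) ^ (-(d : ℝ))) :
    (∫⁻ x, F x ^ (-(d : ℝ))) + ENNReal.ofReal t * ∫⁻ x, G x ^ (-(d : ℝ)) ≤
      ∫⁻ x, H x ^ (-(d : ℝ)) := by
  obtain ⟨d, rfl⟩ := Nat.exists_eq_add_of_le' hd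
  rw [lintegral_fin_succ (by fun_prop), lintegral_fin_succ (by fun_prop),
    lintegral_fin_succ (by fun_prop)]
  have hslice : ∀ K : (Fin (d + 1 + 1) → ℝ) → ℝ≥0∞, Measurable K →
      Measurable fun s : ℝ => ∫⁻ y, K (Fin.cons s y) ^ (-((d + 1 : ℕ) : ℝ)) := by
    intro K hK
    have : Measurable fun p : ℝ × (Fin (d + 1) → ℝ) =>
        K (Fin.cons p.1 p.2) ^ (-((d + 1 : ℕ) : ℝ)) :=
      (measurable_comp_finCons hK).pow_const _
    exact this.lintegral_prod_right'
  refine lintegral_add_le_of_min_le (hslice F hF) (hslice G hG) (hslice H hH) ht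
    (fun s₁ s₂ => ?_) hs
  have hms : ∀ (K : (Fin (d + 1 + 1) → ℝ) → ℝ≥0∞) (s : ℝ), Measurable K →
      Measurable fun y : Fin (d + 1) → ℝ => K (Fin.cons s y) := fun K s hK =>
    (measurable_comp_finCons hK).comp (measurable_const.prodMk measurable_id)
  push_cast
  refine min_lintegral_rpow_neg_le ht d _ _ _ (hms F _ hF) (hms G _ hG) (hms H _ hH)
    fun y₁ y₂ => ?_
  rw [finCons_add_smul]
  exact h _ _

lemma lintegral_euc {n : ℕ} {F : Euc n → ℝ≥0∞} (hF : Measurable F) :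
    ∫⁻ x, F x = ∫⁻ y : Fin n → ℝ, F (WithLp.toLp 2 y) :=
  ((PiLp.volume_preserving_toLp (Fin n)).lintegral_comp hF).symm

lemma ofReal_rpow_neg_natCast {r : ℝ} (hr : 0 < r) (k : ℕ) :
    ENNReal.ofReal r ^ (-(k : ℝ)) = ENNReal.ofReal ((r ^ k)⁻¹) := by
  rw [ENNReal.ofReal_rpow_of_pos hr, Real.rpow_neg hr.le, Real.rpow_natCast]

/-- The largest integral of `f⁻ᵈ` over the hyperplanes on which the first coordinate is
constant. -/
def sliceSup {d : ℕ} (f : Euc (d + 1) → ℝ) : ℝ≥0∞ :=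
  ⨆ s : ℝ, ∫⁻ y : Fin d → ℝ, ENNReal.ofReal (f (WithLp.toLp 2 (Fin.cons s y))) ^ (-(d : ℝ))

lemma integral_inv_pow_add_le {d : ℕ} (hd : 1 ≤ d) {f g w : Euc (d + 1) → ℝ} {t : ℝ} (ht : 0 < t)
    (hf : Continuous f) (hg : Continuous g) (hw : Continuous w)
    (hf0 : ∀ x, 0 < f x) (hg0 : ∀ x, 0 < g x) (hw0 : ∀ x, 0 < w x)
    (hfi : Integrable fun x => (f x ^ d)⁻¹) (hgi : Integrable fun x => (g x ^ d)⁻¹)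
    (hwi : Integrable fun x => (w x ^ d)⁻¹)
    (h : ∀ x y, w (x + t • y) ≤ f x + t * g y) (hs : sliceSup f = sliceSup g) :
    (∫ x, (f x ^ d)⁻¹) + t * ∫ x, (g x ^ d)⁻¹ ≤ ∫ x, (w x ^ d)⁻¹ := by
  have hconv : ∀ k : Euc (d + 1) → ℝ, Continuous k → (∀ x, 0 < k x) →
      Integrable (fun x => (k x ^ d)⁻¹) →
      ∫⁻ y : Fin (d + 1) → ℝ, ENNReal.ofReal (k (WithLp.toLp 2 y)) ^ (-(d : ℝ)) =
        ENNReal.ofReal (∫ x, (k x ^ d)⁻¹) := by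
    intro k hk hk0 hki
    rw [ofReal_integral_eq_lintegral_ofReal hki
      (Eventually.of_forall fun x => (inv_pos.2 (pow_pos (hk0 x) d)).le),
      lintegral_euc (by have := hki.1; have := hk.measurable; fun_prop)]
    exact lintegral_congr fun y => ofReal_rpow_neg_natCast (hk0 _) d
  have hm : ∀ k : Euc (d + 1) → ℝ, Continuous k →
      Measurable fun y : Fin (d + 1) → ℝ => ENNReal.ofReal (k (WithLp.toLp 2 y)) := by
    intro k hk
    exact ENNReal.measurable_ofReal.comp
      (hk.measurable.comp (PiLp.volume_preserving_toLp (Fin (d + 1))).measurable)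
  have key := lintegral_rpow_neg_add_le ht hd (hm f hf) (hm g hg) (hm w hw) (fun x y => ?_) hs
  · rw [hconv f hf hf0 hfi, hconv g hg hg0 hgi, hconv w hw hw0 hwi, ← ENNReal.ofReal_mul ht.le,
      ← ENNReal.ofReal_add] at key
    · refine (ENNReal.ofReal_le_ofReal_iff ?_).1 key
      exact integral_nonneg fun x => (inv_pos.2 (pow_pos (hw0 x) d)).le
    · exact integral_nonneg fun x => (inv_pos.2 (pow_pos (hf0 x) d)).le
    · exact mul_nonneg ht.le (integral_nonneg fun x => (inv_pos.2 (pow_pos (hg0 x) d)).le)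
  · rw [← ENNReal.ofReal_mul ht.le, ← ENNReal.ofReal_add (hf0 _).le (mul_pos ht (hg0 _)).le]
    exact ENNReal.ofReal_le_ofReal (h _ _)

lemma integrable_inv_pow_of_le {E : Type*} [NormedAddCommGroup E] [NormedSpace ℝ E]
    [FiniteDimensional ℝ E] [MeasurableSpace E] [BorelSpace E] {μ : Measure E}
    [μ.IsAddHaarMeasure] {f : E → ℝ} (hf : Continuous f) {c : ℝ} (hc : 0 < c)
    (hcf : ∀ x : E, c * (1 + ‖x‖ ^ 2) ≤ f x) {k : ℕ} (hk : Module.finrank ℝ E < 2 * k) :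
    Integrable (fun x => (f x ^ k)⁻¹) μ := by
  have h1 : Integrable (fun x : E => (c ^ k)⁻¹ * (1 + ‖x‖ ^ 2) ^ (-(2 * k : ℝ) / 2)) μ :=
    (integrable_rpow_neg_one_add_norm_sq (by exact_mod_cast hk)).const_mul _
  have h0 : ∀ x : E, 0 < c * (1 + ‖x‖ ^ 2) := fun x => by positivity
  refine h1.mono' ?_ (Eventually.of_forall fun x => ?_)
  · refine (Continuous.inv₀ (by fun_prop) fun x => ?_).aestronglyMeasurable
    exact (pow_pos ((h0 x).trans_le (hcf x)) k).ne'
  · have hfx := (h0 x).trans_le (hcf x)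
    rw [Real.norm_of_nonneg (by positivity)]
    have e : -(2 * k : ℝ) / 2 = -(k : ℝ) := by ring
    rw [e, Real.rpow_neg (by positivity), Real.rpow_natCast, ← mul_inv, ← mul_pow]
    gcongr
    exact hcf x

lemma inv_one_add_pow_le {x M : ℝ} (d : ℕ) (hxM : |x| ≤ M) (h : d * M ≤ 1 / 2) (hM : M < 1) :
    ((1 + x) ^ d)⁻¹ ≤ 1 - d * x + 2 * d ^ 2 * M ^ 2 := by
  have hx := abs_le.1 hxM
  have hM0 : 0 ≤ M := (abs_nonneg x).trans hxM
  have h1 : 1 + d * x ≤ (1 + x) ^ d := one_add_mul_le_pow (by linarith) d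
  have hd : (0 : ℝ) ≤ d := Nat.cast_nonneg d
  have h2 : -(1 / 2) ≤ d * x := by nlinarith
  have h2' : (d * x) ^ 2 ≤ d ^ 2 * M ^ 2 := by
    rw [mul_pow]
    have : x ^ 2 ≤ M ^ 2 := sq_le_sq.2 (by rwa [abs_of_nonneg hM0])
    gcongr
  calc ((1 + x) ^ d)⁻¹ ≤ (1 + d * x)⁻¹ := by gcongr; linarith
    _ ≤ 1 - d * x + 2 * (d * x) ^ 2 := by
      rw [inv_le_iff_one_le_mul₀ (by linarith)]
      nlinarith [sq_nonneg (d * x : ℝ), mul_nonneg (sq_nonneg (d * x : ℝ))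
        (by linarith : (0 : ℝ) ≤ 1 + 2 * (d * x))]
    _ ≤ _ := by linarith

/-- Positive functions of exactly quadratic growth which are semiconvex with gradient `G`. -/
structure IsAdmissible {n : ℕ} (f : Euc n → ℝ) (G : Euc n → Euc n) (c L C : ℝ) : Prop where
  cont : Continuous f
  cont_grad : Continuous G
  c_pos : 0 < c
  C_pos : 0 < C
  lower : ∀ x, c * (1 + ‖x‖ ^ 2) ≤ f x
  grad_le : ∀ x, ‖G x‖ ^ 2 ≤ L * f x
  semiconvex : ∀ z y, f z + inner ℝ (G z) y - C * ‖y‖ ^ 2 ≤ f (z + y)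

namespace IsAdmissible

variable {n : ℕ} {f : Euc n → ℝ} {G : Euc n → Euc n} {c L C : ℝ}

lemma c_le (h : IsAdmissible f G c L C) (x : Euc n) : c ≤ f x := by
  nlinarith [h.lower x, h.c_pos, sq_nonneg ‖x‖]

lemma pos (h : IsAdmissible f G c L C) (x : Euc n) : 0 < f x := h.c_pos.trans_le (h.c_le x)

lemma L_nonneg (h : IsAdmissible f G c L C) : 0 ≤ L := by
  by_contra hL
  have := h.grad_le 0
  nlinarith [h.pos 0, sq_nonneg ‖G 0‖]

lemma const_mul (h : IsAdmissible f G c L C) {κ : ℝ} (hκ : 0 < κ) :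
    IsAdmissible (fun x => κ * f x) (fun x => κ • G x) (κ * c) (κ * L) (κ * C) where
  cont := h.cont.const_mul κ
  cont_grad := h.cont_grad.const_smul κ
  c_pos := mul_pos hκ h.c_pos
  C_pos := mul_pos hκ h.C_pos
  lower x := by rw [mul_assoc]; exact mul_le_mul_of_nonneg_left (h.lower x) hκ.le
  grad_le x := by
    rw [norm_smul, Real.norm_of_nonneg hκ.le]
    nlinarith [mul_le_mul_of_nonneg_left (h.grad_le x) (sq_nonneg κ)]
  semiconvex z y := by
    rw [real_inner_smul_left]
    nlinarith [mul_le_mul_of_nonneg_left (h.semiconvex z y) hκ.le]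

lemma integrable_inv_pow (h : IsAdmissible f G c L C) {k : ℕ} (hk : n < 2 * k) :
    Integrable fun x => (f x ^ k)⁻¹ :=
  integrable_inv_pow_of_le h.cont h.c_pos h.lower (by simpa using hk)

lemma integrable_grad (h : IsAdmissible f G c L C) {k : ℕ} (hk : n < 2 * k) :
    Integrable fun x => (f x ^ (k + 1))⁻¹ * ‖G x‖ ^ 2 := by
  have hk' := (h.integrable_inv_pow hk).const_mul L
  refine hk'.mono' ?_ (Eventually.of_forall fun x => ?_)
  · refine Continuous.aestronglyMeasurable (Continuous.mul (Continuous.inv₀ ?_ fun x => ?_) ?_)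
    · exact h.cont.pow _
    · exact (pow_pos (h.pos x) _).ne'
    · exact h.cont_grad.norm.pow 2
  · have := h.pos x
    rw [Real.norm_of_nonneg (by positivity)]
    calc (f x ^ (k + 1))⁻¹ * ‖G x‖ ^ 2 ≤ (f x ^ (k + 1))⁻¹ * (L * f x) := by
          gcongr; exact h.grad_le x
      _ = _ := by field_simp; ring

end IsAdmissible

lemma isAdmissible_add_sq {n : ℕ} {δ : ℝ} (hδ : 0 < δ) :
    IsAdmissible (fun x : Euc n => δ ^ 2 + ‖x‖ ^ 2) (fun x => (2 : ℝ) • x) (min (δ ^ 2) 1) 4 1 where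
  cont := by fun_prop
  cont_grad := by fun_prop
  c_pos := by positivity
  C_pos := one_pos
  lower x := by
    nlinarith [min_le_left (δ ^ 2) 1, min_le_right (δ ^ 2) 1, sq_nonneg ‖x‖]
  grad_le x := by
    rw [norm_smul, Real.norm_of_nonneg (by norm_num)]
    nlinarith [sq_nonneg δ]
  semiconvex z y := by
    rw [real_inner_smul_left, norm_add_sq_real]
    nlinarith [sq_nonneg ‖y‖]

namespace IsAdmissible

variable {d : ℕ} {f : Euc (d + 1) → ℝ} {G : Euc (d + 1) → Euc (d + 1)} {c L C : ℝ}

/-- The Hopf–Lax type competitor lies below the infimal convolution. -/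
lemma hopfLax_le {n : ℕ} {f : Euc n → ℝ} {G : Euc n → Euc n} (h : IsAdmissible f G c L C)
    {t δ : ℝ} (ht : 0 < t) (htC : C * t < 1) (x y : Euc n) :
    f (x + t • y) + t * (δ ^ 2 - ‖G (x + t • y)‖ ^ 2 / (4 * (1 - C * t))) ≤
      f x + t * (δ ^ 2 + ‖y‖ ^ 2) := by
  set z := x + t • y with hz
  have hx : x = z + -(t • y) := by rw [hz]; abel
  have h1 := h.semiconvex z (-(t • y))
  rw [← hx, inner_neg_right, real_inner_smul_right, norm_neg, norm_smul,
    Real.norm_of_nonneg ht.le] at h1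
  have hs : 0 < 1 - C * t := by linarith
  have h2 : inner ℝ (G z) y ≤ ‖G z‖ * ‖y‖ := real_inner_le_norm _ _
  have h3 : ‖G z‖ * ‖y‖ ≤ ‖G z‖ ^ 2 / (4 * (1 - C * t)) + (1 - C * t) * ‖y‖ ^ 2 := by
    have e : ‖G z‖ ^ 2 / (4 * (1 - C * t)) + (1 - C * t) * ‖y‖ ^ 2 - ‖G z‖ * ‖y‖ =
        (‖G z‖ - 2 * (1 - C * t) * ‖y‖) ^ 2 / (4 * (1 - C * t)) := by
      field_simp; ring
    have : 0 ≤ (‖G z‖ - 2 * (1 - C * t) * ‖y‖) ^ 2 / (4 * (1 - C * t)) := by positivity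
    linarith
  nlinarith [mul_le_mul_of_nonneg_left (h2.trans h3) ht.le]

/-- Gagliardo–Nirenberg type inequality obtained by linearising Borell–Brascamp–Lieb. -/
lemma integral_add_le_of_sliceSup_eq (h : IsAdmissible f G c L C) (hd : 2 ≤ d) {δ : ℝ}
    (hδ : 0 < δ) (hs : sliceSup f = sliceSup fun x : Euc (d + 1) => δ ^ 2 + ‖x‖ ^ 2) :
    (∫ x : Euc (d + 1), ((δ ^ 2 + ‖x‖ ^ 2) ^ d)⁻¹) + d * δ ^ 2 * ∫ x, (f x ^ (d + 1))⁻¹ ≤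
      d / 4 * ∫ x, (f x ^ (d + 1))⁻¹ * ‖G x‖ ^ 2 := by
  have hg := isAdmissible_add_sq (n := d + 1) hδ
  have hfd : Integrable fun x => (f x ^ d)⁻¹ := h.integrable_inv_pow (by lia)
  have hfI : Integrable fun x => (f x ^ (d + 1))⁻¹ := h.integrable_inv_pow (by lia)
  have hfE : Integrable fun x => (f x ^ (d + 1))⁻¹ * ‖G x‖ ^ 2 := h.integrable_grad (by lia)
  set A := ∫ x, (f x ^ d)⁻¹ with hA
  set I := ∫ x, (f x ^ (d + 1))⁻¹ with hI
  set E := ∫ x, (f x ^ (d + 1))⁻¹ * ‖G x‖ ^ 2 with hE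
  set B := ∫ x : Euc (d + 1), ((δ ^ 2 + ‖x‖ ^ 2) ^ d)⁻¹ with hB
  set M := δ ^ 2 / c + L / 2 with hM
  have hc := h.c_pos
  have hC := h.C_pos
  have hL := h.L_nonneg
  have hM0 : 0 < M := by positivity
  have hd0 : (0 : ℝ) < d := by exact_mod_cast (by lia : 0 < d)
  have key : ∀ t : ℝ, 0 < t → t ≤ 1 / (2 * C) → t ≤ 1 / (2 * d * M) → t < 1 / M →
      B ≤ - d * δ ^ 2 * I + d / (4 * (1 - C * t)) * E + t * (2 * d ^ 2 * M ^ 2 * A) := by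
    intro t ht htC htM htM'
    have htC' : C * t ≤ 1 / 2 := by
      rw [le_div_iff₀ (by positivity)] at htC; linarith
    have htM1 : d * (t * M) ≤ 1 / 2 := by
      rw [le_div_iff₀ (by positivity)] at htM; linarith
    have htM2 : t * M < 1 := by rwa [lt_div_iff₀ hM0] at htM'
    have hs0 : 0 < 1 - C * t := by linarith
    set ψ : Euc (d + 1) → ℝ := fun x =>
      t * (δ ^ 2 - ‖G x‖ ^ 2 / (4 * (1 - C * t))) / f x with hψ
    set w : Euc (d + 1) → ℝ := fun x =>
      f x + t * (δ ^ 2 - ‖G x‖ ^ 2 / (4 * (1 - C * t))) with hw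
    have hwψ : ∀ x, w x = f x * (1 + ψ x) := by
      intro x
      have := (h.pos x).ne'
      simp only [hw, hψ]
      field_simp
    have hψM : ∀ x, |ψ x| ≤ t * M := by
      intro x
      have hfx := h.pos x
      have h1 : ‖G x‖ ^ 2 / (4 * (1 - C * t)) ≤ L / 2 * f x := by
        rw [div_le_iff₀ (by linarith)]
        have := h.grad_le x
        have : 0 ≤ L * f x := by positivity
        nlinarith
      have h2 : 0 ≤ ‖G x‖ ^ 2 / (4 * (1 - C * t)) := by positivity
      have h3 : δ ^ 2 ≤ δ ^ 2 / c * f x := by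
        rw [div_mul_eq_mul_div, le_div_iff₀ hc]
        gcongr
        exact h.c_le x
      have h4 : 0 ≤ L / 2 * f x := by positivity
      simp only [hψ]
      rw [abs_div, abs_mul, abs_of_pos ht, abs_of_pos hfx, div_le_iff₀ hfx, mul_assoc]
      gcongr
      rw [hM, abs_le]
      constructor <;> nlinarith [sq_nonneg δ]
    have hw0 : ∀ x, 0 < w x := by
      intro x
      rw [hwψ]
      have := abs_le.1 (hψM x)
      exact mul_pos (h.pos x) (by linarith)
    have hwc : Continuous w := by
      have := h.cont
      have := h.cont_grad
      fun_prop
    have hpt : ∀ x, (w x ^ d)⁻¹ ≤ (1 + t * (2 * d ^ 2 * M ^ 2) * t) * (f x ^ d)⁻¹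
        - t * d * δ ^ 2 * (f x ^ (d + 1))⁻¹
        + t * d / (4 * (1 - C * t)) * ((f x ^ (d + 1))⁻¹ * ‖G x‖ ^ 2) := by
      intro x
      have hfx := h.pos x
      have h1 := inv_one_add_pow_le d (hψM x) htM1 htM2
      rw [hwψ, mul_pow, mul_inv]
      calc (f x ^ d)⁻¹ * ((1 + ψ x) ^ d)⁻¹
          ≤ (f x ^ d)⁻¹ * (1 - d * ψ x + 2 * d ^ 2 * (t * M) ^ 2) := by gcongr
        _ = _ := by
          simp only [hψ, pow_succ (f x) d]
          field_simp
          ring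
    have hRi := ((hfd.const_mul (1 + t * (2 * d ^ 2 * M ^ 2) * t)).sub
      (hfI.const_mul (t * d * δ ^ 2))).add (hfE.const_mul (t * d / (4 * (1 - C * t))))
    have hwi : Integrable fun x => (w x ^ d)⁻¹ := by
      refine hRi.mono' ?_ (Eventually.of_forall fun x => ?_)
      · exact (Continuous.inv₀ (hwc.pow d) fun x =>
          (pow_pos (hw0 x) d).ne').aestronglyMeasurable
      · rw [Real.norm_of_nonneg (inv_pos.2 (pow_pos (hw0 x) d)).le]
        exact hpt x
    have h1 := integral_inv_pow_add_le (by lia) ht h.cont hg.cont hwc h.pos hg.pos hw0 hfd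
      (hg.integrable_inv_pow (by lia)) hwi (fun x y => h.hopfLax_le ht (by linarith) x y) hs
    have h2 : ∫ x, (w x ^ d)⁻¹ ≤ (1 + t * (2 * d ^ 2 * M ^ 2) * t) * A - t * d * δ ^ 2 * I +
        t * d / (4 * (1 - C * t)) * E := by
      refine (integral_mono hwi hRi hpt).trans (le_of_eq ?_)
      simp only [Pi.add_apply, Pi.sub_apply]
      rw [integral_add, integral_sub, integral_const_mul, integral_const_mul, integral_const_mul]
      · exact hfd.const_mul _
      · exact hfI.const_mul _
      · exact (hfd.const_mul _).sub (hfI.const_mul _)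
      · exact hfE.const_mul _
    have h3 : t * B ≤ t * (- d * δ ^ 2 * I + d / (4 * (1 - C * t)) * E +
        t * (2 * d ^ 2 * M ^ 2 * A)) := by
      have e : t * (- d * δ ^ 2 * I + d / (4 * (1 - C * t)) * E +
        t * (2 * d ^ 2 * M ^ 2 * A)) = (1 + t * (2 * d ^ 2 * M ^ 2) * t) * A -
          t * d * δ ^ 2 * I + t * d / (4 * (1 - C * t)) * E - A := by ring
      rw [e]
      linarith
    exact le_of_mul_le_mul_left h3 ht
  have hlim : Tendsto (fun t : ℝ => - d * δ ^ 2 * I + d / (4 * (1 - C * t)) * E +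
      t * (2 * d ^ 2 * M ^ 2 * A)) (𝓝[>] 0)
      (𝓝 (- d * δ ^ 2 * I + d / (4 * (1 - C * 0)) * E + 0 * (2 * d ^ 2 * M ^ 2 * A))) := by
    refine Tendsto.mono_left (ContinuousAt.tendsto ?_) nhdsWithin_le_nhds
    refine ContinuousAt.add (ContinuousAt.add continuousAt_const (ContinuousAt.mul
      (ContinuousAt.div continuousAt_const (by fun_prop) (by norm_num)) continuousAt_const))
      (by fun_prop)
  have hle := ge_of_tendsto hlim (b := B) ?_
  · simp only [mul_zero, sub_zero, mul_one, zero_mul, add_zero] at hle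
    linarith
  · have hev : ∀ r : ℝ, 0 < r → ∀ᶠ t in 𝓝[>] (0 : ℝ), t < r := fun r hr =>
      (eventually_lt_nhds hr).filter_mono nhdsWithin_le_nhds
    filter_upwards [self_mem_nhdsWithin, hev (1 / (2 * C)) (by positivity),
      hev (1 / (2 * d * M)) (by positivity), hev (1 / M) (by positivity)] with t h1 h2 h3 h4
    exact key t h1 h2.le h3.le h4

lemma measurable_slice {k : Euc (d + 1) → ℝ} (hk : Continuous k) (s : ℝ) :
    Measurable fun y : Fin d → ℝ =>
      ENNReal.ofReal (k (WithLp.toLp 2 (Fin.cons s y))) ^ (-(d : ℝ)) := by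
  have h1 : Measurable fun y : Fin d → ℝ => (Fin.cons s y : Fin (d + 1) → ℝ) :=
    (measurePreserving_finCons d).measurable.comp (measurable_const.prodMk measurable_id)
  have h2 := hk.measurable.comp ((PiLp.volume_preserving_toLp (Fin (d + 1))).measurable.comp h1)
  exact (ENNReal.measurable_ofReal.comp h2).pow_const _

lemma sliceSup_ne_top (h : IsAdmissible f G c L C) (hd : 1 ≤ d) : sliceSup f ≠ ∞ := by
  have hc := h.c_pos
  have hgint : Integrable (fun y : Fin d → ℝ => ((c * (1 + ‖y‖ ^ 2)) ^ d)⁻¹) :=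
    integrable_inv_pow_of_le (by fun_prop) hc (fun y => le_rfl) (by simp; lia)
  have hlt := hgint.lintegral_lt_top
  refine ne_top_of_le_ne_top hlt.ne (iSup_le fun s => lintegral_mono fun y => ?_)
  rw [ofReal_rpow_neg_natCast (h.pos _)]
  refine ENNReal.ofReal_le_ofReal ?_
  have hle : c * (1 + ‖y‖ ^ 2) ≤ f (WithLp.toLp 2 (Fin.cons s y)) := by
    refine le_trans ?_ (h.lower _)
    gcongr
    rw [pi_norm_le_iff_of_nonneg (norm_nonneg _)]
    intro i
    have := PiLp.norm_apply_le (WithLp.toLp 2 (Fin.cons s y) : Euc (d + 1)) i.succ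
    simpa using this
  gcongr

lemma sliceSup_ne_zero (h : IsAdmissible f G c L C) : sliceSup f ≠ 0 := by
  intro h0
  have h1 : ∫⁻ y : Fin d → ℝ,
      ENNReal.ofReal (f (WithLp.toLp 2 (Fin.cons 0 y))) ^ (-(d : ℝ)) = 0 :=
    le_antisymm (h0 ▸ le_iSup (fun s : ℝ => ∫⁻ y : Fin d → ℝ,
      ENNReal.ofReal (f (WithLp.toLp 2 (Fin.cons s y))) ^ (-(d : ℝ))) 0) zero_le
  rw [lintegral_eq_zero_iff (measurable_slice h.cont 0)] at h1
  obtain ⟨y, hy⟩ := h1.exists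
  change ENNReal.ofReal (f (WithLp.toLp 2 (Fin.cons 0 y))) ^ (-(d : ℝ)) = 0 at hy
  rw [ofReal_rpow_neg_natCast (h.pos _)] at hy
  rw [ENNReal.ofReal_eq_zero] at hy
  exact absurd hy (not_le.2 (inv_pos.2 (pow_pos (h.pos _) d)))

lemma exists_sliceSup_const_mul_eq (h : IsAdmissible f G c L C) (hd : 1 ≤ d) {g : Euc (d + 1) → ℝ}
    (hg0 : sliceSup g ≠ 0) (hg1 : sliceSup g ≠ ∞) :
    ∃ κ : ℝ, 0 < κ ∧ sliceSup (fun x => κ * f x) = sliceSup g := by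
  have hf0 := h.sliceSup_ne_zero
  have hf1 := h.sliceSup_ne_top hd
  set r := sliceSup f / sliceSup g with hr
  have hr0 : r ≠ 0 := ENNReal.div_ne_zero.2 ⟨hf0, hg1⟩
  have hr1 : r ≠ ∞ := ENNReal.div_ne_top hf1 hg0
  have hrp : 0 < r.toReal := ENNReal.toReal_pos hr0 hr1
  have hd0 : (d : ℝ) ≠ 0 := by exact_mod_cast (by lia : d ≠ 0)
  refine ⟨r.toReal ^ (1 / (d : ℝ)), by positivity, ?_⟩
  set κ := r.toReal ^ (1 / (d : ℝ)) with hκ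
  have hκ0 : 0 < κ := by positivity
  have e1 : ENNReal.ofReal κ ^ (-(d : ℝ)) = r⁻¹ := by
    rw [hκ, ← ENNReal.ofReal_rpow_of_pos hrp, ENNReal.ofReal_toReal hr1, ← ENNReal.rpow_mul]
    have : 1 / (d : ℝ) * -d = -1 := by field_simp
    rw [this, ENNReal.rpow_neg_one]
  have e2 : sliceSup (fun x => κ * f x) = r⁻¹ * sliceSup f := by
    rw [sliceSup, sliceSup, ENNReal.mul_iSup]
    refine iSup_congr fun s => ?_
    rw [← lintegral_const_mul _ (measurable_slice h.cont s)]
    refine lintegral_congr fun y => ?_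
    rw [ENNReal.ofReal_mul hκ0.le, ENNReal.mul_rpow_of_ne_top ENNReal.ofReal_ne_top
      ENNReal.ofReal_ne_top, e1]
  rw [e2, hr, ENNReal.inv_div (Or.inl hg1) (Or.inl hg0), ENNReal.div_mul_cancel hf0 hf1]

/-- The Gagliardo–Nirenberg type inequality after rescaling an arbitrary admissible function. -/
lemma exists_integral_add_le (h : IsAdmissible f G c L C) (hd : 2 ≤ d) {δ : ℝ} (hδ : 0 < δ) :
    ∃ κ : ℝ, 0 < κ ∧ (∫ x : Euc (d + 1), ((δ ^ 2 + ‖x‖ ^ 2) ^ d)⁻¹) +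
      d * δ ^ 2 * ((κ ^ (d + 1))⁻¹ * ∫ x, (f x ^ (d + 1))⁻¹) ≤
      d / 4 * ((κ ^ (d - 1))⁻¹ * ∫ x, (f x ^ (d + 1))⁻¹ * ‖G x‖ ^ 2) := by
  have hg := isAdmissible_add_sq (n := d + 1) hδ
  obtain ⟨κ, hκ, hs⟩ := h.exists_sliceSup_const_mul_eq (by lia) hg.sliceSup_ne_zero
    (hg.sliceSup_ne_top (by lia))
  refine ⟨κ, hκ, ?_⟩
  have key := (h.const_mul hκ).integral_add_le_of_sliceSup_eq hd hδ hs
  have e1 : ∫ x, ((κ * f x) ^ (d + 1))⁻¹ = (κ ^ (d + 1))⁻¹ * ∫ x, (f x ^ (d + 1))⁻¹ := by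
    simp only [mul_pow, mul_inv, integral_const_mul]
  have e2 : ∫ x, ((κ * f x) ^ (d + 1))⁻¹ * ‖κ • G x‖ ^ 2 =
      (κ ^ (d - 1))⁻¹ * ∫ x, (f x ^ (d + 1))⁻¹ * ‖G x‖ ^ 2 := by
    rw [← integral_const_mul]
    refine integral_congr_ae (Eventually.of_forall fun x => ?_)
    have hfx := h.pos x
    obtain ⟨d, rfl⟩ := Nat.exists_eq_add_of_le' hd
    simp only [norm_smul, Real.norm_of_nonneg hκ.le, show d + 2 - 1 = d + 1 by lia, pow_succ, mul_pow]
    field_simp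
  rwa [e1, e2] at key

end IsAdmissible

lemma hasFDerivAt_inv_add_sq_pow {n : ℕ} {δ : ℝ} (hδ : 0 < δ) (m : ℕ) (x : Euc n) :
    HasFDerivAt (fun x : Euc n => ((δ ^ 2 + ‖x‖ ^ 2) ^ m)⁻¹)
      (-(2 * m * ((δ ^ 2 + ‖x‖ ^ 2) ^ (m + 1))⁻¹) • innerSL ℝ x) x := by
  have h1 : HasFDerivAt (fun x : Euc n => δ ^ 2 + ‖x‖ ^ 2) ((2 : ℝ) • innerSL ℝ x) x := by
    have := ((hasFDerivAt_id x).norm_sq).const_add (δ ^ 2)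
    refine this.congr_fderiv ?_
    ext v
    simp [two_smul]
  have h0 : 0 < δ ^ 2 + ‖x‖ ^ 2 := by positivity
  have h2 : HasDerivAt (fun r : ℝ => (r ^ m)⁻¹) (-(m * ((δ ^ 2 + ‖x‖ ^ 2) ^ (m + 1))⁻¹))
      (δ ^ 2 + ‖x‖ ^ 2) := by
    refine ((hasDerivAt_pow m (δ ^ 2 + ‖x‖ ^ 2)).inv (pow_pos h0 m).ne').congr_deriv ?_
    rcases m with _ | m
    · simp
    · rw [Nat.add_sub_cancel]
      field_simp
      ring
  refine (h2.comp_hasFDerivAt x h1).congr_fderiv ?_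
  rw [smul_smul]
  congr 1
  ring

lemma integrable_coord_mul_inv_add_sq_pow {n : ℕ} {δ : ℝ} (hδ : 0 < δ) {m : ℕ}
    (hm : n + 1 < 2 * m) (i : Fin n) :
    Integrable fun x : Euc n => x i * ((δ ^ 2 + ‖x‖ ^ 2) ^ m)⁻¹ := by
  set c := min (δ ^ 2) 1
  have hc : 0 < c := by positivity
  have h1 : Integrable fun x : Euc n => (c ^ m)⁻¹ * (1 + ‖x‖ ^ 2) ^ (-(2 * m - 1 : ℝ) / 2) := by
    refine (integrable_rpow_neg_one_add_norm_sq ?_).const_mul _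
    have : ((n + 1 : ℕ) : ℝ) < (2 * m : ℕ) := by exact_mod_cast hm
    push_cast at this
    simp only [finrank_euclideanSpace, Fintype.card_fin]
    linarith
  refine h1.mono' ?_ (Eventually.of_forall fun x => ?_)
  · refine Continuous.aestronglyMeasurable (Continuous.mul (by fun_prop)
      (Continuous.inv₀ (by fun_prop) fun x => by positivity))
  · have hx : (0 : ℝ) < 1 + ‖x‖ ^ 2 := by positivity
    have hle : |x i| ≤ (1 + ‖x‖ ^ 2) ^ (1 / 2 : ℝ) := by
      rw [← Real.sqrt_eq_rpow]
      refine Real.le_sqrt_of_sq_le ?_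
      have := PiLp.norm_apply_le x i
      rw [Real.norm_eq_abs] at this
      nlinarith [abs_nonneg (x i)]
    have e : (-(2 * m - 1 : ℝ) / 2) = -(m : ℝ) + 1 / 2 := by ring
    rw [norm_mul, Real.norm_eq_abs, Real.norm_of_nonneg (by positivity), e, Real.rpow_add hx,
      Real.rpow_neg hx.le, Real.rpow_natCast, ← mul_assoc, ← mul_inv, ← mul_pow, mul_comm]
    gcongr
    exact (isAdmissible_add_sq hδ).lower x

/-- The mass of the `n`-dimensional bubble at scale `δ`. -/
def bubbleMass (n : ℕ) (δ : ℝ) : ℝ := ∫ x : Euc n, ((δ ^ 2 + ‖x‖ ^ 2) ^ n)⁻¹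

lemma integrable_inv_add_sq_pow {n : ℕ} {δ : ℝ} (hδ : 0 < δ) {m : ℕ} (hm : n < 2 * m) :
    Integrable fun x : Euc n => ((δ ^ 2 + ‖x‖ ^ 2) ^ m)⁻¹ :=
  (isAdmissible_add_sq hδ).integrable_inv_pow hm

lemma integrable_sq_mul_inv_add_sq_pow {n : ℕ} {δ : ℝ} (hδ : 0 < δ) {m : ℕ} (hm : n < 2 * m) :
    Integrable fun x : Euc n => ‖x‖ ^ 2 * ((δ ^ 2 + ‖x‖ ^ 2) ^ (m + 1))⁻¹ := by
  refine (((isAdmissible_add_sq (n := n) hδ).integrable_grad hm).const_mul (1 / 4)).congr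
    (Eventually.of_forall fun x => ?_)
  simp only [norm_smul, Real.norm_ofNat]
  ring

lemma bubbleMass_pos {n : ℕ} (hn : 0 < n) {δ : ℝ} (hδ : 0 < δ) : 0 < bubbleMass n δ := by
  refine (integral_pos_iff_support_of_nonneg (fun x => by positivity)
    (integrable_inv_add_sq_pow hδ (by lia))).2 ?_
  have : Function.support (fun x : Euc n => ((δ ^ 2 + ‖x‖ ^ 2) ^ n)⁻¹) = Set.univ :=
    Set.eq_univ_of_forall fun x => by
      rw [Function.mem_support]
      positivity
  rw [this]
  exact Measure.measure_univ_pos.2 (NeZero.ne _)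

lemma two_mul_integral_sq_mul_eq {n : ℕ} {δ : ℝ} (hδ : 0 < δ) {m : ℕ} (hm : n + 1 < 2 * m) :
    2 * m * ∫ x : Euc n, ‖x‖ ^ 2 * ((δ ^ 2 + ‖x‖ ^ 2) ^ (m + 1))⁻¹ =
      n * ∫ x : Euc n, ((δ ^ 2 + ‖x‖ ^ 2) ^ m)⁻¹ := by
  set g : Euc n → ℝ := fun x => ((δ ^ 2 + ‖x‖ ^ 2) ^ m)⁻¹ with hg
  have hgi : Integrable g := integrable_inv_add_sq_pow hδ (by lia)
  have hpart : ∀ i : Fin n, Integrable (fun x : Euc n =>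
      x i ^ 2 * ((δ ^ 2 + ‖x‖ ^ 2) ^ (m + 1))⁻¹) := by
    intro i
    refine (integrable_sq_mul_inv_add_sq_pow hδ (m := m) (by lia)).mono' ?_
      (Eventually.of_forall fun x => ?_)
    · refine Continuous.aestronglyMeasurable (Continuous.mul (by fun_prop)
        (Continuous.inv₀ (by fun_prop) fun x => by positivity))
    · rw [Real.norm_of_nonneg (by positivity)]
      refine mul_le_mul_of_nonneg_right ?_ (by positivity)
      rw [EuclideanSpace.real_norm_sq_eq]
      exact Finset.single_le_sum (f := fun j => x j ^ 2) (fun j _ => sq_nonneg _)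
        (Finset.mem_univ i)
  have hi : ∀ i : Fin n, 2 * m * ∫ x : Euc n, x i ^ 2 * ((δ ^ 2 + ‖x‖ ^ 2) ^ (m + 1))⁻¹ =
      ∫ x, g x := by
    intro i
    have hd : ∀ x : Euc n, fderiv ℝ g x (EuclideanSpace.single i 1) =
        -(2 * m * ((δ ^ 2 + ‖x‖ ^ 2) ^ (m + 1))⁻¹) * x i := by
      intro x
      rw [(hasFDerivAt_inv_add_sq_pow hδ m x).fderiv]
      simp [EuclideanSpace.inner_single_right]
    have hc : ∀ x : Euc n, fderiv ℝ (fun x : Euc n => x i) x (EuclideanSpace.single i 1) = 1 := by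
      intro x
      have := (EuclideanSpace.proj i : Euc n →L[ℝ] ℝ).hasFDerivAt (x := x)
      change fderiv ℝ (EuclideanSpace.proj i : Euc n →L[ℝ] ℝ) x _ = 1
      rw [this.fderiv]
      simp
    have hpt : ∀ x : Euc n, x i * (-(2 * m * ((δ ^ 2 + ‖x‖ ^ 2) ^ (m + 1))⁻¹) * x i) =
        -(2 * m) * (x i ^ 2 * ((δ ^ 2 + ‖x‖ ^ 2) ^ (m + 1))⁻¹) := fun x => by ring
    have key := integral_mul_fderiv_eq_neg_fderiv_mul_of_integrable (μ := volume)
      (f := fun x : Euc n => x i) (g := g) (v := EuclideanSpace.single i 1)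
      (by simpa only [hc, one_mul] using hgi)
      (by simp only [hd, hpt]; exact (hpart i).const_mul _)
      (integrable_coord_mul_inv_add_sq_pow hδ hm i) (fun x _ => by fun_prop)
      (fun x _ => (hasFDerivAt_inv_add_sq_pow hδ m x).differentiableAt)
    simp only [hd, hc, hpt, one_mul, integral_const_mul] at key
    linarith
  have hsum : ∫ x : Euc n, ‖x‖ ^ 2 * ((δ ^ 2 + ‖x‖ ^ 2) ^ (m + 1))⁻¹ =
      ∑ i, ∫ x : Euc n, x i ^ 2 * ((δ ^ 2 + ‖x‖ ^ 2) ^ (m + 1))⁻¹ := by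
    rw [← integral_finsetSum _ fun i _ => hpart i]
    refine integral_congr_ae (Eventually.of_forall fun x => ?_)
    simp only [EuclideanSpace.real_norm_sq_eq x, Finset.sum_mul]
  rw [hsum, Finset.mul_sum, Finset.sum_congr rfl fun i _ => hi i]
  simp

lemma integral_inv_add_sq_pow_eq {n : ℕ} {δ : ℝ} (hδ : 0 < δ) {m : ℕ} (hm : n < 2 * m) :
    ∫ x : Euc n, ((δ ^ 2 + ‖x‖ ^ 2) ^ m)⁻¹ = δ ^ 2 * (∫ x : Euc n, ((δ ^ 2 + ‖x‖ ^ 2) ^ (m + 1))⁻¹) +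
      ∫ x : Euc n, ‖x‖ ^ 2 * ((δ ^ 2 + ‖x‖ ^ 2) ^ (m + 1))⁻¹ := by
  rw [← integral_const_mul, ← integral_add ((integrable_inv_add_sq_pow hδ (by lia)).const_mul _)
    (integrable_sq_mul_inv_add_sq_pow hδ hm)]
  refine integral_congr_ae (Eventually.of_forall fun x => ?_)
  have h0 : 0 < δ ^ 2 + ‖x‖ ^ 2 := by positivity
  simp only [← add_mul, pow_succ]
  field_simp

/-- The Dirichlet energy of the bubble in terms of its mass. -/
lemma integral_sq_mul_inv_add_sq_pow {n : ℕ} (hn : 4 ≤ n) {δ : ℝ} (hδ : 0 < δ) :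
    (n - 2) * ∫ x : Euc n, ‖x‖ ^ 2 * ((δ ^ 2 + ‖x‖ ^ 2) ^ n)⁻¹ =
      n * δ ^ 2 * bubbleMass n δ := by
  obtain ⟨m, rfl⟩ : ∃ m, n = m + 1 := ⟨n - 1, by lia⟩
  have h1 := two_mul_integral_sq_mul_eq (n := m + 1) hδ (m := m) (by lia)
  rw [integral_inv_add_sq_pow_eq hδ (by lia)] at h1
  rw [bubbleMass]
  push_cast at h1 ⊢
  linarith

/-- The sharp Sobolev inequality for admissible functions, in the variable `f = u ^ (-2/(n-2))`. -/
lemma IsAdmissible.sobolev {n : ℕ} (hn : 4 ≤ n) {f : Euc n → ℝ} {G : Euc n → Euc n}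
    {c L C : ℝ} (h : IsAdmissible f G c L C) {δ : ℝ} (hδ : 0 < δ) :
    n * (n - 2) * δ ^ 2 * bubbleMass n δ ^ (2 / (n : ℝ)) *
      (∫ x, (f x ^ n)⁻¹) ^ (((n : ℝ) - 2) / n) ≤
      (n - 2) ^ 2 / 4 * ∫ x, (f x ^ n)⁻¹ * ‖G x‖ ^ 2 := by
  have hJ := bubbleMass_pos (n := n) (by lia) hδ
  have hK := integral_sq_mul_inv_add_sq_pow hn hδ
  obtain ⟨m, rfl⟩ : ∃ m, n = m + 3 := ⟨n - 3, by lia⟩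
  obtain ⟨κ, hκ, hle⟩ := h.exists_integral_add_le (by lia) hδ
  rw [integral_inv_add_sq_pow_eq hδ (by lia)] at hle
  change δ ^ 2 * bubbleMass (m + 3) δ + _ + _ ≤ _ at hle
  change (_ - 2) * (∫ x : Euc (m + 3), ‖x‖ ^ 2 * ((δ ^ 2 + ‖x‖ ^ 2) ^ (m + 2 + 1))⁻¹) = _ at hK
  set J := bubbleMass (m + 3) δ
  set K := ∫ x : Euc (m + 3), ‖x‖ ^ 2 * ((δ ^ 2 + ‖x‖ ^ 2) ^ (m + 2 + 1))⁻¹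
  set E := ∫ x, (f x ^ (m + 3))⁻¹ * ‖G x‖ ^ 2
  set I := ∫ x, (f x ^ (m + 3))⁻¹
  have hI : 0 ≤ I := integral_nonneg fun x => (inv_pos.2 (pow_pos (h.pos x) _)).le
  have hn0 : (0 : ℝ) < (m + 3 : ℕ) := by positivity
  have hn2 : ((m + 3 : ℕ) : ℝ) - 2 = m + 1 := by push_cast; ring
  have hm0 : (0 : ℝ) < m + 1 := by positivity
  have hm3 : (0 : ℝ) < m + 3 := by positivity
  have hag := Real.geom_mean_le_arith_mean2_weighted (w₁ := 2 / (m + 3 : ℕ))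
    (w₂ := ((m + 3 : ℕ) - 2) / (m + 3 : ℕ)) (p₁ := J * κ ^ (m + 1)) (p₂ := I * (κ ^ 2)⁻¹)
    (by positivity) (by rw [hn2]; positivity) (by positivity) (by positivity) (by field_simp; ring)
  have hκκ : (κ ^ (m + 1)) ^ (2 / ((m + 3 : ℕ) : ℝ)) *
      ((κ ^ 2)⁻¹) ^ ((((m + 3 : ℕ) : ℝ) - 2) / (m + 3 : ℕ)) = 1 := by
    rw [hn2, Real.inv_rpow (by positivity), ← Real.rpow_natCast κ (m + 1), ← Real.rpow_natCast κ 2,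
      ← Real.rpow_mul hκ.le, ← Real.rpow_mul hκ.le, mul_inv_eq_one₀ (by positivity)]
    congr 1
    push_cast
    ring
  have hprod : (J * κ ^ (m + 1)) ^ (2 / ((m + 3 : ℕ) : ℝ)) *
      (I * (κ ^ 2)⁻¹) ^ ((((m + 3 : ℕ) : ℝ) - 2) / (m + 3 : ℕ)) =
      J ^ (2 / ((m + 3 : ℕ) : ℝ)) * I ^ ((((m + 3 : ℕ) : ℝ) - 2) / (m + 3 : ℕ)) := by
    rw [Real.mul_rpow hJ.le (by positivity), Real.mul_rpow hI (by positivity), mul_mul_mul_comm,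
      hκκ, mul_one]
  rw [hprod] at hag
  rw [mul_assoc _ (J ^ _)]
  set P := J ^ (2 / ((m + 3 : ℕ) : ℝ)) * I ^ ((((m + 3 : ℕ) : ℝ) - 2) / (m + 3 : ℕ))
  rw [hn2] at hK hag ⊢
  have hK' : K = (m + 3) * δ ^ 2 * J / (m + 1) := by
    rw [eq_div_iff hm0.ne']
    push_cast at hK
    linarith
  have hle' : 2 * δ ^ 2 * J * κ ^ (m + 1) / (m + 1) + δ ^ 2 * (I * (κ ^ 2)⁻¹) ≤ E / 4 := by
    have hm2 : (0 : ℝ) < m + 2 := by positivity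
    rw [hK'] at hle
    simp only [show m + 2 - 1 = m + 1 by lia, show m + 2 + 1 = m + 1 + 2 by lia] at hle
    have := mul_le_mul_of_nonneg_left hle (by positivity : 0 ≤ κ ^ (m + 1) / (m + 2))
    push_cast at this
    refine le_trans (le_of_eq ?_) (this.trans (le_of_eq ?_))
    · rw [pow_add κ (m + 1) 2]
      field_simp
      ring
    · field_simp
  push_cast at hag ⊢
  calc (m + 3) * (m + 1) * δ ^ 2 * P
      ≤ (m + 3) * (m + 1) * δ ^ 2 * (2 / (m + 3) * (J * κ ^ (m + 1)) +
        (m + 1) / (m + 3) * (I * (κ ^ 2)⁻¹)) := by gcongr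
    _ = (m + 1) ^ 2 * (2 * δ ^ 2 * J * κ ^ (m + 1) / (m + 1) + δ ^ 2 * (I * (κ ^ 2)⁻¹)) := by
      field_simp
    _ ≤ (m + 1) ^ 2 * (E / 4) := by gcongr
    _ = _ := by ring

lemma norm_gradient_eq {n : ℕ} (f : Euc n → ℝ) (x : Euc n) : ‖gradient f x‖ = ‖fderiv ℝ f x‖ := by
  rw [← (InnerProductSpace.toDual ℝ (Euc n)).norm_map, toDual_gradient]

lemma contDiff_one_add_sq {n : ℕ} {k : WithTop ℕ∞} (κ : ℝ) :
    ContDiff ℝ k fun x : Euc n => κ * (1 + ‖x‖ ^ 2) :=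
  contDiff_const.mul (contDiff_const.add (contDiff_norm_sq ℝ))

/-- A compactly supported smooth perturbation of a quadratic function is admissible. -/
lemma exists_isAdmissible {n : ℕ} {f : Euc n → ℝ} {κ c : ℝ} (hf : ContDiff ℝ 2 f)
    (hs : HasCompactSupport fun x => f x - κ * (1 + ‖x‖ ^ 2)) (hc : 0 < c)
    (hlow : ∀ x, c * (1 + ‖x‖ ^ 2) ≤ f x) : ∃ L C, IsAdmissible f (gradient f) c L C := by
  set φ : Euc n → ℝ := fun x => f x - κ * (1 + ‖x‖ ^ 2) with hφ
  have hφd : ContDiff ℝ 2 φ := hf.sub (contDiff_one_add_sq κ)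
  have hdiff : ∀ x, HasFDerivAt φ (fderiv ℝ φ x) x := fun x =>
    (hφd.differentiable two_ne_zero x).hasFDerivAt
  have hφ' : ContDiff ℝ 1 (fderiv ℝ φ) := hφd.fderiv_right (by norm_num)
  obtain ⟨K, hK⟩ := ContDiff.lipschitzWith_of_hasCompactSupport (hs.fderiv (𝕜 := ℝ)) hφ' one_ne_zero
  obtain ⟨M, hM⟩ := hφ'.continuous.bounded_above_of_compact_support (hs.fderiv (𝕜 := ℝ))
  have hM0 : 0 ≤ M := (norm_nonneg _).trans (hM 0)
  have hgrad : ∀ x, HasGradientAt f ((2 * κ) • x + gradient φ x) x := by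
    intro x
    rw [hasGradientAt_iff_hasFDerivAt]
    have h1 : HasFDerivAt (fun x : Euc n => κ * (1 + ‖x‖ ^ 2)) ((2 * κ) • innerSL ℝ x) x := by
      refine ((((hasFDerivAt_id x).norm_sq).const_add 1).const_mul κ).congr_fderiv ?_
      ext v
      simp
      ring
    have h2 := h1.add (hdiff x)
    have e : ((fun x : Euc n => κ * (1 + ‖x‖ ^ 2)) + φ) = f := by
      ext y; simp [hφ]
    rw [e] at h2
    refine h2.congr_fderiv ?_
    rw [map_add, toDual_gradient]
    ext v
    simp
  refine ⟨(8 * κ ^ 2 + 2 * M ^ 2) / c, K + |κ| + 1, ?_⟩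
  constructor
  · exact hf.continuous
  · change Continuous fun x => (InnerProductSpace.toDual ℝ (Euc n)).symm (fderiv ℝ f x)
    exact (InnerProductSpace.toDual ℝ (Euc n)).symm.continuous.comp
      (hf.continuous_fderiv two_ne_zero)
  · exact hc
  · positivity
  · exact hlow
  · intro x
    rw [(hgrad x).gradient]
    have h1 : ‖gradient φ x‖ ≤ M := (norm_gradient_eq φ x).trans_le (hM x)
    have h2 : ‖(2 * κ) • x + gradient φ x‖ ≤ 2 * |κ| * ‖x‖ + M := by
      refine (norm_add_le _ _).trans (add_le_add (le_of_eq ?_) h1)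
      rw [norm_smul, norm_mul, Real.norm_ofNat, Real.norm_eq_abs]
    rw [div_mul_eq_mul_div, le_div_iff₀ hc]
    calc ‖(2 * κ) • x + gradient φ x‖ ^ 2 * c ≤ (2 * |κ| * ‖x‖ + M) ^ 2 * c := by gcongr
      _ ≤ (8 * κ ^ 2 + 2 * M ^ 2) * (1 + ‖x‖ ^ 2) * c := by
        gcongr
        nlinarith [sq_nonneg (2 * |κ| * ‖x‖ - M), sq_abs κ, sq_nonneg (M * ‖x‖), sq_nonneg κ]
      _ = (8 * κ ^ 2 + 2 * M ^ 2) * (c * (1 + ‖x‖ ^ 2)) := by ring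
      _ ≤ _ := by gcongr; exact hlow x
  · intro z y
    rw [(hgrad z).gradient, inner_add_left, inner_gradient_left, real_inner_smul_left]
    have h1 := (convex_closedBall z ‖y‖).norm_image_sub_le_of_norm_fderiv_le' (𝕜 := ℝ) (f := φ)
      (φ := fderiv ℝ φ z) (C := K * ‖y‖) (x := z) (y := z + y)
      (fun x _ => (hdiff x).differentiableAt) (fun x hx => ?_) (by simp) (by simp)
    · rw [add_sub_cancel_left, Real.norm_eq_abs] at h1
      have h2 := neg_le_of_abs_le h1
      have h3 : f (z + y) = κ * (1 + ‖z + y‖ ^ 2) + φ (z + y) := by simp [hφ]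
      have h4 : f z = κ * (1 + ‖z‖ ^ 2) + φ z := by simp [hφ]
      rw [h3, h4, norm_add_sq_real]
      nlinarith [neg_abs_le κ, sq_nonneg ‖y‖]
    · refine (hK.norm_sub_le x z).trans ?_
      rw [mem_closedBall_iff_norm] at hx
      gcongr

/-- The positive function `u² + ε² (1 + |x|²)⁻ᵐ`, where `m = n - 2`. -/
def regSq {n : ℕ} (m : ℕ) (u : Euc n → ℝ) (ε : ℝ) (x : Euc n) : ℝ :=
  u x ^ 2 + ε ^ 2 * ((1 + ‖x‖ ^ 2) ^ m)⁻¹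

section regSq

variable {n m : ℕ} {u : Euc n → ℝ} {ε : ℝ}

lemma regSq_pos (hε : 0 < ε) (x : Euc n) : 0 < regSq m u ε x := by
  have : 0 < ε ^ 2 * ((1 + ‖x‖ ^ 2) ^ m)⁻¹ := by positivity
  rw [regSq]
  positivity

lemma contDiff_regSq {k : WithTop ℕ∞} (hu : ContDiff ℝ k u) : ContDiff ℝ k (regSq m u ε) := by
  refine (hu.pow 2).add (contDiff_const.mul (ContDiff.inv ?_ fun x => by positivity))
  exact (contDiff_const.add (contDiff_norm_sq ℝ)).pow m

lemma hasGradientAt_regSq (hu : Differentiable ℝ u) (x : Euc n) :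
    HasGradientAt (regSq m u ε) ((2 * u x) • gradient u x +
      (-(2 * m * ε ^ 2 * ((1 + ‖x‖ ^ 2) ^ (m + 1))⁻¹)) • x) x := by
  rw [hasGradientAt_iff_hasFDerivAt]
  have h1 := (hu x).hasFDerivAt.pow 2
  have h2 : HasFDerivAt (fun x : Euc n => ((1 + ‖x‖ ^ 2) ^ m)⁻¹)
      ((-(2 * m * ((1 + ‖x‖ ^ 2) ^ (m + 1))⁻¹) : ℝ) • innerSL ℝ x) x := by
    simpa using hasFDerivAt_inv_add_sq_pow one_pos m x
  refine (h1.add (h2.const_mul (ε ^ 2))).congr_fderiv ?_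
  rw [map_add, map_smul, toDual_gradient]
  ext v
  simp
  ring

lemma hasGradientAt_regSq_rpow (hε : 0 < ε) (hu : Differentiable ℝ u) (r : ℝ) (x : Euc n) :
    HasGradientAt (fun x => regSq m u ε x ^ r) ((r * regSq m u ε x ^ (r - 1)) •
      ((2 * u x) • gradient u x + (-(2 * m * ε ^ 2 * ((1 + ‖x‖ ^ 2) ^ (m + 1))⁻¹)) • x)) x := by
  have h := hasGradientAt_iff_hasFDerivAt.1 (hasGradientAt_regSq (m := m) (ε := ε) hu x)
  rw [hasGradientAt_iff_hasFDerivAt]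
  refine (h.rpow_const (Or.inl (regSq_pos hε x).ne')).congr_fderiv ?_
  rw [map_smul]

lemma norm_gradient_regSq_le (hn : n = m + 2) (x : Euc n) :
    ‖(2 * u x) • gradient u x + (-(2 * m * ε ^ 2 * ((1 + ‖x‖ ^ 2) ^ (m + 1))⁻¹)) • x‖ ^ 2 ≤
      4 * regSq m u ε x *
        (‖gradient u x‖ ^ 2 + ε ^ 2 * (m ^ 2 * (‖x‖ ^ 2 * ((1 + ‖x‖ ^ 2) ^ n)⁻¹))) := by
  set A := ‖gradient u x‖
  set β := ε ^ 2 * ((1 + ‖x‖ ^ 2) ^ m)⁻¹ with hβ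
  set e := ε ^ 2 * (m ^ 2 * (‖x‖ ^ 2 * ((1 + ‖x‖ ^ 2) ^ n)⁻¹)) with he
  set b := 2 * m * ε ^ 2 * ((1 + ‖x‖ ^ 2) ^ (m + 1))⁻¹ * ‖x‖ with hb
  have hβ0 : 0 ≤ β := by positivity
  have he0 : 0 ≤ e := by positivity
  have hb0 : 0 ≤ b := by positivity
  have hA0 : 0 ≤ A := norm_nonneg _
  have hbe : b ^ 2 = 4 * β * e := by
    rw [hb, hβ, he, congrArg (fun k => ((1 + ‖x‖ ^ 2) ^ k)⁻¹) hn]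
    field_simp
    ring
  have h1 : ‖(2 * u x) • gradient u x + (-(2 * m * ε ^ 2 * ((1 + ‖x‖ ^ 2) ^ (m + 1))⁻¹)) • x‖ ≤
      2 * |u x| * A + b := by
    refine (norm_add_le _ _).trans (le_of_eq ?_)
    rw [norm_smul, norm_smul, norm_mul, Real.norm_ofNat, norm_neg, Real.norm_eq_abs,
      Real.norm_of_nonneg (by positivity)]
  have h2 : |u x| * A * b ≤ u x ^ 2 * e + β * A ^ 2 := by
    refine abs_le_of_sq_le_sq' ?_ (by positivity) |>.2
    have : (|u x| * A * b) ^ 2 = 4 * (u x ^ 2 * e) * (β * A ^ 2) := by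
      rw [mul_pow, mul_pow, hbe, sq_abs]
      ring
    rw [this]
    nlinarith [sq_nonneg (u x ^ 2 * e - β * A ^ 2)]
  calc _ ≤ (2 * |u x| * A + b) ^ 2 := by gcongr
    _ = 4 * u x ^ 2 * A ^ 2 + 4 * (|u x| * A * b) + b ^ 2 := by
      rw [← sq_abs (u x)]
      ring
    _ ≤ 4 * u x ^ 2 * A ^ 2 + 4 * (u x ^ 2 * e + β * A ^ 2) + 4 * β * e := by
      rw [hbe]
      gcongr
    _ = _ := by
      rw [regSq, ← hβ]
      ring

lemma exists_isAdmissible_regSq (hm : 0 < m) (hε : 0 < ε) (hu : ContDiff ℝ (⊤ : ℕ∞) u)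
    (hs : HasCompactSupport u) : ∃ c L C,
      IsAdmissible (fun x => regSq m u ε x ^ (-(1 / (m : ℝ))))
        (gradient fun x => regSq m u ε x ^ (-(1 / (m : ℝ)))) c L C := by
  have hm0 : (m : ℝ) ≠ 0 := by positivity
  have hpow : ∀ a : ℝ, 0 ≤ a → ∀ x : Euc n, (a * ((1 + ‖x‖ ^ 2) ^ m)⁻¹) ^ (-(1 / (m : ℝ))) =
      a ^ (-(1 / (m : ℝ))) * (1 + ‖x‖ ^ 2) := by
    intro a ha x
    rw [Real.mul_rpow ha (by positivity), Real.inv_rpow (by positivity),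
      Real.rpow_neg (x := (1 + ‖x‖ ^ 2) ^ m) (by positivity), inv_inv, one_div, Real.pow_rpow_inv_natCast (by positivity) hm.ne']
  have hcs : HasCompactSupport fun x => u x ^ 2 * (1 + ‖x‖ ^ 2) ^ m :=
    (hs.comp_left (g := fun r : ℝ => r ^ 2) (by simp)).mul_right
  obtain ⟨M, hM⟩ := Continuous.bounded_above_of_compact_support (by
    have := hu.continuous
    fun_prop) hcs
  have hM0 : 0 ≤ M := (norm_nonneg _).trans (hM 0)
  have hsupp : HasCompactSupport fun x => regSq m u ε x ^ (-(1 / (m : ℝ))) -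
      (ε ^ 2) ^ (-(1 / (m : ℝ))) * (1 + ‖x‖ ^ 2) := by
    refine hs.mono fun x hx => ?_
    contrapose! hx
    rw [Function.notMem_support] at hx ⊢
    rw [regSq, hx, zero_pow two_ne_zero, zero_add, hpow _ (sq_nonneg ε), sub_self]
  have hlow : ∀ x, (M + ε ^ 2) ^ (-(1 / (m : ℝ))) * (1 + ‖x‖ ^ 2) ≤
      regSq m u ε x ^ (-(1 / (m : ℝ))) := by
    intro x
    rw [← hpow _ (by positivity)]
    refine Real.rpow_le_rpow_of_nonpos (regSq_pos hε x) ?_ (by simp)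
    have h1 := hM x
    rw [Real.norm_of_nonneg (by positivity)] at h1
    rw [regSq, add_mul]
    gcongr
    rwa [← div_eq_mul_inv, le_div_iff₀ (by positivity)]
  exact ⟨_, exists_isAdmissible ((contDiff_regSq (contDiff_infty.1 hu 2)).rpow_const_of_ne
    fun x => (regSq_pos hε x).ne') hsupp (by positivity) hlow⟩

end regSq

lemma integrable_norm_gradient_sq {n : ℕ} {u : Euc n → ℝ} (hu : ContDiff ℝ (⊤ : ℕ∞) u)
    (hs : HasCompactSupport u) : Integrable fun x => ‖gradient u x‖ ^ 2 := by
  simp only [norm_gradient_eq]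
  refine Continuous.integrable_of_hasCompactSupport
    ((hu.continuous_fderiv (by simp)).norm.pow 2) ?_
  exact (hs.fderiv (𝕜 := ℝ)).comp_left (g := fun l : Euc n →L[ℝ] ℝ => ‖l‖ ^ 2) (by simp)

lemma integrable_abs_rpow {n : ℕ} {u : Euc n → ℝ} (hu : Continuous u)
    (hs : HasCompactSupport u) {q : ℝ} (hq : 0 < q) : Integrable fun x => |u x| ^ q :=
  (hu.abs.rpow_const fun _ => Or.inr hq.le).integrable_of_hasCompactSupport
    (hs.comp_left (g := fun r : ℝ => |r| ^ q) (by simp [hq.ne']))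

/-- The sharp Sobolev inequality on `ℝⁿ`; the constant does not depend on `δ`. -/
lemma bubble_mul_le_integral_norm_gradient_sq {n : ℕ} (hn : 4 ≤ n) {u : Euc n → ℝ}
    (hu : ContDiff ℝ (⊤ : ℕ∞) u) (hs : HasCompactSupport u) {δ : ℝ} (hδ : 0 < δ) :
    n * (n - 2) * δ ^ 2 * bubbleMass n δ ^ (2 / (n : ℝ)) *
      (∫ x, |u x| ^ (2 * (n : ℝ) / (n - 2))) ^ (((n : ℝ) - 2) / n) ≤
      ∫ x, ‖gradient u x‖ ^ 2 := by
  obtain ⟨m, hnm⟩ : ∃ m, n = m + 2 := ⟨n - 2, by lia⟩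
  have hm : 0 < m := by lia
  have hm0 : (0 : ℝ) < m := by exact_mod_cast hm
  have hcast : (n : ℝ) - 2 = m := by rw [hnm]; push_cast; ring
  have hcast' : (n : ℝ) = m + 2 := by linarith
  have hJ := bubbleMass_pos (n := n) (by lia) hδ
  set K := ∫ x : Euc n, ‖x‖ ^ 2 * ((1 + ‖x‖ ^ 2) ^ n)⁻¹ with hK
  have hKi : Integrable fun x : Euc n => ‖x‖ ^ 2 * ((1 + ‖x‖ ^ 2) ^ n)⁻¹ := by
    have := integrable_sq_mul_inv_add_sq_pow (n := n) one_pos (m := m + 1) (by lia)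
    simpa [hnm] using this
  have hgi := integrable_norm_gradient_sq hu hs
  have hdiff : Differentiable ℝ u := hu.differentiable (by simp)
  rw [hcast]
  set Z := ∫ x, |u x| ^ (2 * (n : ℝ) / m)
  have hZ : 0 ≤ Z := integral_nonneg fun x => by positivity
  have key : ∀ ε : ℝ, 0 < ε → n * m * δ ^ 2 * bubbleMass n δ ^ (2 / (n : ℝ)) * Z ^ ((m : ℝ) / n) ≤
      (∫ x, ‖gradient u x‖ ^ 2) + ε ^ 2 * (m ^ 2 * K) := by
    intro ε hε
    obtain ⟨c, L, C, h⟩ := exists_isAdmissible_regSq hm hε hu hs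
    have hsob := h.sobolev hn hδ
    rw [hcast] at hsob
    have hinv : ∀ x, ((regSq m u ε x ^ (-(1 / (m : ℝ)))) ^ n)⁻¹ = regSq m u ε x ^ ((n : ℝ) / m) := by
      intro x
      rw [← Real.rpow_natCast, ← Real.rpow_mul (regSq_pos hε x).le,
        ← Real.rpow_neg (regSq_pos hε x).le]
      congr 1
      ring
    have hI : Z ≤ ∫ x, ((regSq m u ε x ^ (-(1 / (m : ℝ)))) ^ n)⁻¹ := by
      refine integral_mono (integrable_abs_rpow hu.continuous hs (by positivity))
        (h.integrable_inv_pow (by lia)) fun x => ?_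
      simp only [hinv]
      have e : |u x| ^ (2 * (n : ℝ) / m) = (u x ^ 2) ^ ((n : ℝ) / m) := by
        rw [← sq_abs, ← Real.rpow_natCast, ← Real.rpow_mul (abs_nonneg _)]
        congr 1
        push_cast
        ring
      rw [e]
      refine Real.rpow_le_rpow (sq_nonneg _) ?_ (by positivity)
      rw [regSq]
      have : 0 ≤ ε ^ 2 * ((1 + ‖x‖ ^ 2) ^ m)⁻¹ := by positivity
      linarith
    have hE : ∫ x, ((regSq m u ε x ^ (-(1 / (m : ℝ)))) ^ n)⁻¹ *
        ‖gradient (fun x => regSq m u ε x ^ (-(1 / (m : ℝ)))) x‖ ^ 2 ≤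
        4 / m ^ 2 * ((∫ x, ‖gradient u x‖ ^ 2) + ε ^ 2 * (m ^ 2 * K)) := by
      rw [hK, ← integral_const_mul, ← integral_const_mul, ← integral_add hgi
        ((hKi.const_mul _).const_mul _), ← integral_const_mul]
      have hgint := h.integrable_grad (k := n - 1) (by lia)
      rw [show n - 1 + 1 = n by lia] at hgint
      refine integral_mono hgint ((hgi.add ((hKi.const_mul _).const_mul _)).const_mul _) fun x => ?_
      have hp := regSq_pos (m := m) (u := u) hε x
      simp only [hinv, (hasGradientAt_regSq_rpow (m := m) hε hdiff _ x).gradient]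
      rw [norm_smul, mul_pow, Real.norm_eq_abs, sq_abs]
      have hb := norm_gradient_regSq_le (u := u) (ε := ε) hnm x
      have e : regSq m u ε x ^ ((n : ℝ) / m) *
          (-(1 / (m : ℝ)) * regSq m u ε x ^ (-(1 / (m : ℝ)) - 1)) ^ 2 =
          1 / m ^ 2 * (regSq m u ε x)⁻¹ := by
        rw [mul_pow, ← Real.rpow_natCast (regSq m u ε x ^ _) 2, ← Real.rpow_mul hp.le,
          mul_left_comm, ← Real.rpow_add hp, ← Real.rpow_neg_one]
        congr 1
        · ring
        · congr 1
          rw [hcast']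
          push_cast
          field_simp
          ring
      rw [← mul_assoc, e]
      calc _ ≤ 1 / m ^ 2 * (regSq m u ε x)⁻¹ * _ := mul_le_mul_of_nonneg_left hb (by positivity)
        _ = _ := by field_simp
    calc _ ≤ n * m * δ ^ 2 * bubbleMass n δ ^ (2 / (n : ℝ)) *
          (∫ x, ((regSq m u ε x ^ (-(1 / (m : ℝ)))) ^ n)⁻¹) ^ ((m : ℝ) / n) := by gcongr
      _ ≤ _ := hsob
      _ ≤ m ^ 2 / 4 * (4 / m ^ 2 * ((∫ x, ‖gradient u x‖ ^ 2) + ε ^ 2 * (m ^ 2 * K))) := by gcongr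
      _ = _ := by field_simp
  have hlim : Tendsto (fun ε : ℝ => (∫ x, ‖gradient u x‖ ^ 2) + ε ^ 2 * (m ^ 2 * K)) (𝓝[>] 0)
      (𝓝 ((∫ x, ‖gradient u x‖ ^ 2) + 0 ^ 2 * (m ^ 2 * K))) :=
    Tendsto.mono_left (Continuous.tendsto (by fun_prop) 0) nhdsWithin_le_nhds
  have := ge_of_tendsto hlim (eventually_mem_nhdsWithin.mono fun ε hε => key ε hε)
  simpa using this

lemma CondA.exists_le_add_sq {n : ℕ} {p : Euc n → ℝ} {a : Euc n} {p₀ k β : ℝ}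
    (hA : CondA p a p₀ k β) (hpa : p a = p₀) (hk : 2 < k) {η : ℝ} (hη : 0 < η) :
    ∀ᶠ x in 𝓝 a, p x ≤ p₀ + η * ‖x - a‖ ^ 2 := by
  have h1 : ∀ᶠ x in 𝓝[≠] a, (p x - p₀) / ‖x - a‖ ^ k < β + 1 :=
    hA.eventually_lt_const (by linarith)
  have hc : Tendsto (fun x : Euc n => (β + 1) * ‖x - a‖ ^ (k - 2)) (𝓝 a)
      (𝓝 ((β + 1) * ‖a - a‖ ^ (k - 2))) := by
    refine Continuous.tendsto (continuous_const.mul (Continuous.rpow_const (by fun_prop)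
      fun x => Or.inr (by linarith))) a
  rw [sub_self, norm_zero, Real.zero_rpow (by linarith), mul_zero] at hc
  have h2 := hc.eventually_lt_const hη
  filter_upwards [eventually_nhdsWithin_iff.1 h1, h2] with x hx1 hx2
  rcases eq_or_ne x a with rfl | hxa
  · simp [hpa]
  · have hpos : 0 < ‖x - a‖ := norm_pos_iff.2 (sub_ne_zero.2 hxa)
    have h3 := hx1 hxa
    rw [div_lt_iff₀ (by positivity)] at h3
    have e : ‖x - a‖ ^ k = ‖x - a‖ ^ (k - 2) * ‖x - a‖ ^ 2 := by
      rw [← Real.rpow_natCast, ← Real.rpow_add hpos]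
      congr 1
      push_cast
      ring
    rw [e, ← mul_assoc] at h3
    nlinarith [mul_le_mul_of_nonneg_right hx2.le (sq_nonneg ‖x - a‖)]

lemma not_integrableOn_ball_inv_norm_pow {n m : ℕ} (hnm : n = m + 2) (hm : 2 ≤ m) {ρ : ℝ}
    (hρ : 0 < ρ) :
    ¬ IntegrableOn (fun x : Euc n => ((‖x‖ ^ 2) ^ m)⁻¹) (Metric.ball 0 ρ) := by
  intro h
  have : Nontrivial (Euc n) := Module.nontrivial_of_finrank_pos (R := ℝ) (by simp; lia)
  rw [← integrable_indicator_iff measurableSet_ball] at h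
  have e : (Metric.ball (0 : Euc n) ρ).indicator (fun x => ((‖x‖ ^ 2) ^ m)⁻¹) =
      fun x => (Set.Iio ρ).indicator (fun s : ℝ => ((s ^ 2) ^ m)⁻¹) ‖x‖ := by
    ext x
    by_cases hx : ‖x‖ < ρ
    · rw [Set.indicator_of_mem (mem_ball_zero_iff.2 hx), Set.indicator_of_mem (Set.mem_Iio.2 hx)]
    · rw [Set.indicator_of_notMem (by simpa using hx), Set.indicator_of_notMem (by simpa using hx)]
  rw [e, integrable_fun_norm_addHaar volume] at h
  have h1 := h.mono_set (Set.Ioo_subset_Ioi_self : Set.Ioo 0 ρ ⊆ Set.Ioi 0)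
  have h2 : IntegrableOn (fun s : ℝ => s ^ (1 - m : ℝ)) (Set.Ioo 0 ρ) := by
    refine h1.congr_fun (fun s hs => ?_) measurableSet_Ioo
    have hs0 := hs.1
    simp only [Set.indicator_of_mem (Set.mem_Iio.2 hs.2), finrank_euclideanSpace, Fintype.card_fin,
      smul_eq_mul]
    rw [show n - 1 = m + 1 by lia, ← pow_mul, ← Real.rpow_natCast, ← Real.rpow_natCast,
      ← Real.rpow_neg hs0.le, ← Real.rpow_add hs0]
    congr 1
    push_cast
    ring
  rw [intervalIntegral.integrableOn_Ioo_rpow_iff hρ] at h2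
  have : (2 : ℝ) ≤ m := by exact_mod_cast hm
  linarith

/-- The `L²` mass of bubbles in a ball blows up in dimension at least four. -/
lemma exists_lt_setIntegral_inv_add_sq_pow {n m : ℕ} (hnm : n = m + 2) (hm : 2 ≤ m) {ρ : ℝ}
    (hρ : 0 < ρ) (K : ℝ) : ∃ δ : ℝ, 0 < δ ∧ δ ≤ 1 ∧
      K < ∫ x : Euc n in Metric.ball 0 ρ, ((δ ^ 2 + ‖x‖ ^ 2) ^ m)⁻¹ := by
  by_contra! hK
  refine not_integrableOn_ball_inv_norm_pow hnm hm hρ ?_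
  have : Nontrivial (Euc n) := Module.nontrivial_of_finrank_pos (R := ℝ) (by simp; lia)
  set δ : ℕ → ℝ := fun j => 1 / (j + 1) with hδ
  have hδ0 : ∀ j, 0 < δ j := fun j => by positivity
  have hδ1 : ∀ j, δ j ≤ 1 := fun j => by
    rw [hδ, div_le_one (by positivity)]
    linarith [(Nat.cast_nonneg j : (0 : ℝ) ≤ j)]
  set F : ℕ → Euc n → ℝ := fun j x => ((δ j ^ 2 + ‖x‖ ^ 2) ^ m)⁻¹ with hF
  have hFc : ∀ j, Continuous (F j) := fun j =>
    Continuous.inv₀ (by fun_prop) fun x => by have := hδ0 j; positivity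
  have hFi : ∀ j, IntegrableOn (F j) (Metric.ball 0 ρ) := fun j =>
    ((hFc j).continuousOn.integrableOn_compact (isCompact_closedBall 0 ρ)).mono_set
      Metric.ball_subset_closedBall
  have hF0 : ∀ j x, 0 ≤ F j x := fun j x => by positivity
  have hlim : ∀ᵐ x : Euc n ∂volume.restrict (Metric.ball 0 ρ),
      Tendsto (fun j => F j x) atTop (𝓝 ((‖x‖ ^ 2) ^ m)⁻¹) := by
    refine ae_restrict_of_ae ?_
    filter_upwards [Measure.ae_ne volume (0 : Euc n)] with x hx
    have hx0 : 0 < ‖x‖ := norm_pos_iff.2 hx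
    have h1 : Tendsto δ atTop (𝓝 0) := tendsto_one_div_add_atTop_nhds_zero_nat
    have h2 := (((h1.pow 2).add_const (‖x‖ ^ 2)).pow m).inv₀ (by positivity)
    simpa using h2
  refine ⟨by fun_prop, ?_⟩
  have hbound : ∫⁻ x in Metric.ball (0 : Euc n) ρ, ‖((‖x‖ ^ 2) ^ m)⁻¹‖ₑ ≤ ENNReal.ofReal K := by
    calc ∫⁻ x in Metric.ball (0 : Euc n) ρ, ‖((‖x‖ ^ 2) ^ m)⁻¹‖ₑ
        = ∫⁻ x in Metric.ball (0 : Euc n) ρ, liminf (fun j => ENNReal.ofReal (F j x)) atTop := by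
          refine lintegral_congr_ae ?_
          filter_upwards [hlim] with x hx
          rw [Real.enorm_of_nonneg (by positivity)]
          exact (((ENNReal.continuous_ofReal.tendsto _).comp hx).liminf_eq).symm
      _ ≤ liminf (fun j => ∫⁻ x in Metric.ball (0 : Euc n) ρ, ENNReal.ofReal (F j x)) atTop :=
          lintegral_liminf_le fun j => (hFc j).measurable.ennreal_ofReal
      _ ≤ liminf (fun _ => ENNReal.ofReal K) atTop := by
          refine liminf_le_liminf (Eventually.of_forall fun j => ?_)
          change _ ≤ ENNReal.ofReal K
          rw [← ofReal_integral_eq_lintegral_ofReal (hFi j) (Eventually.of_forall (hF0 j))]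
          exact ENNReal.ofReal_le_ofReal (hK (δ j) (hδ0 j) (hδ1 j))
      _ = ENNReal.ofReal K := liminf_const _
  exact hbound.trans_lt ENNReal.ofReal_lt_top

/-- The Aubin–Talenti bubble in dimension `m + 2`, up to normalisation. -/
def bubble {n : ℕ} (m : ℕ) (a : Euc n) (δ : ℝ) (x : Euc n) : ℝ :=
  (δ ^ 2 + ‖x - a‖ ^ 2) ^ (-(m : ℝ) / 2)

section bubble

variable {n m : ℕ} {a : Euc n} {δ : ℝ}

lemma bubble_pos (hδ : 0 < δ) (x : Euc n) : 0 < bubble m a δ x := by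
  rw [bubble]
  positivity

lemma bubble_sq (hδ : 0 < δ) (x : Euc n) :
    bubble m a δ x ^ 2 = ((δ ^ 2 + ‖x - a‖ ^ 2) ^ m)⁻¹ := by
  rw [bubble, ← Real.rpow_natCast (_ ^ _) 2, ← Real.rpow_mul (by positivity),
    ← Real.rpow_natCast _ m, ← Real.rpow_neg (by positivity)]
  congr 1
  push_cast
  ring

lemma bubble_rpow (hm : 0 < m) (hδ : 0 < δ) (x : Euc n) :
    bubble m a δ x ^ (2 * (n : ℝ) / m) = ((δ ^ 2 + ‖x - a‖ ^ 2) ^ n)⁻¹ := by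
  have hm0 : (0 : ℝ) < m := by exact_mod_cast hm
  rw [bubble, ← Real.rpow_mul (by positivity), ← Real.rpow_natCast _ n,
    ← Real.rpow_neg (by positivity)]
  congr 1
  field_simp

lemma contDiff_bubble {k : WithTop ℕ∞} (hδ : 0 < δ) : ContDiff ℝ k (bubble m a δ) := by
  refine ContDiff.rpow_const_of_ne ?_ fun x => by positivity
  exact contDiff_const.add ((contDiff_id.sub contDiff_const).norm_sq ℝ)

lemma norm_fderiv_bubble_sq (hnm : n = m + 2) (hδ : 0 < δ) (x : Euc n) :
    ‖fderiv ℝ (bubble m a δ) x‖ ^ 2 =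
      m ^ 2 * (‖x - a‖ ^ 2 * ((δ ^ 2 + ‖x - a‖ ^ 2) ^ n)⁻¹) := by
  have hg : 0 < δ ^ 2 + ‖x - a‖ ^ 2 := by positivity
  have h1 : HasFDerivAt (fun x : Euc n => δ ^ 2 + ‖x - a‖ ^ 2) ((2 : ℝ) • innerSL ℝ (x - a)) x := by
    refine ((((hasFDerivAt_id x).sub_const a).norm_sq).const_add (δ ^ 2)).congr_fderiv ?_
    ext v
    simp [two_smul]
  have h2 := h1.rpow_const (p := -(m : ℝ) / 2) (Or.inl hg.ne')
  rw [show bubble m a δ = fun x => (δ ^ 2 + ‖x - a‖ ^ 2) ^ (-(m : ℝ) / 2) from rfl, h2.fderiv,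
    norm_smul, norm_smul, innerSL_apply_norm, mul_pow, mul_pow, Real.norm_eq_abs, sq_abs, mul_pow,
    ← Real.rpow_natCast (_ ^ _) 2, ← Real.rpow_mul hg.le, ← Real.rpow_natCast _ n,
    ← Real.rpow_neg hg.le]
  have e : (-(m : ℝ) / 2 - 1) * (2 : ℕ) = -(n : ℝ) := by
    rw [hnm]
    push_cast
    ring
  rw [e, Real.norm_ofNat]
  ring

/-- A bubble cut off near its centre is an admissible test function. -/
lemma isTest_bump_mul_bubble (hδ : 0 < δ) (χ : ContDiffBump a) {Ω : Set (Euc n)}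
    (hΩ : Metric.closedBall a χ.rOut ⊆ Ω) : IsTest Ω fun x => χ x * bubble m a δ x := by
  refine ⟨χ.contDiff.mul (contDiff_bubble hδ), χ.hasCompactSupport.mul_right, ?_, fun h => ?_⟩
  · exact (tsupport_mul_subset_left.trans χ.tsupport_eq.subset).trans hΩ
  · have := congrFun h a
    simp only [χ.one_of_mem_closedBall (Metric.mem_closedBall_self χ.rIn_pos.le), Pi.zero_apply,
      one_mul, (bubble_pos hδ a).ne'] at this

end bubble

lemma IsTest.setIntegral_norm_gradient {n : ℕ} {Ω : Set (Euc n)} {u : Euc n → ℝ}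
    (hu : IsTest Ω u) : ∫ x in Ω, ‖gradient u x‖ ^ 2 = ∫ x, ‖gradient u x‖ ^ 2 := by
  refine setIntegral_eq_integral_of_forall_compl_eq_zero fun x hx => ?_
  have h : fderiv ℝ u x = 0 :=
    image_eq_zero_of_notMem_tsupport fun h => hx (hu.2.2.1 (tsupport_fderiv_subset ℝ h))
  simp [norm_gradient_eq, h]

lemma IsTest.setIntegral_abs_rpow {n : ℕ} {Ω : Set (Euc n)} {u : Euc n → ℝ}
    (hu : IsTest Ω u) {q : ℝ} (hq : 0 < q) : ∫ x in Ω, |u x| ^ q = ∫ x, |u x| ^ q := by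
  refine setIntegral_eq_integral_of_forall_compl_eq_zero fun x hx => ?_
  simp [image_eq_zero_of_notMem_tsupport fun h => hx (hu.2.2.1 h), hq.ne']

lemma IsTest.integral_abs_rpow_pos {n : ℕ} {Ω : Set (Euc n)} {u : Euc n → ℝ}
    (hu : IsTest Ω u) {q : ℝ} (hq : 0 < q) : 0 < ∫ x, |u x| ^ q := by
  obtain ⟨x, hx⟩ := Function.ne_iff.1 hu.2.2.2
  refine Continuous.integral_pos_of_hasCompactSupport_nonneg_nonzero (x := x)
    (hu.1.continuous.abs.rpow_const fun _ => Or.inr hq.le)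
    (hu.2.1.comp_left (g := fun r : ℝ => |r| ^ q) (by simp [hq.ne'])) (fun x => by positivity) ?_
  exact (Real.rpow_pos_of_pos (abs_pos.2 hx) q).ne'

lemma le_sobolevS {n : ℕ} (hn : 4 ≤ n) {Ω : Set (Euc n)} (hΩ : ∃ u, IsTest Ω u) {q : ℝ}
    (hq : q = 2 * (n : ℝ) / ((n : ℝ) - 2)) {δ : ℝ} (hδ : 0 < δ) :
    n * (n - 2) * δ ^ 2 * bubbleMass n δ ^ (2 / (n : ℝ)) ≤ SobolevS Ω q := by
  have hn4 : (4 : ℝ) ≤ n := by exact_mod_cast hn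
  have hn2 : (0 : ℝ) < n - 2 := by linarith
  have hq0 : 0 < q := by rw [hq]; positivity
  have hq2 : 2 / q = ((n : ℝ) - 2) / n := by rw [hq]; field_simp
  obtain ⟨u₀, hu₀⟩ := hΩ
  refine le_csInf ⟨_, u₀, hu₀, rfl⟩ ?_
  rintro _ ⟨u, hu, rfl⟩
  rw [hu.setIntegral_norm_gradient, hu.setIntegral_abs_rpow hq0, hq2,
    le_div_iff₀ (Real.rpow_pos_of_pos (hu.integral_abs_rpow_pos hq0) _), hq]
  exact bubble_mul_le_integral_norm_gradient_sq hn hu.1 hu.2.1 hδ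

section cutoff

variable {n m : ℕ} {a : Euc n} {δ : ℝ} {χ : ContDiffBump a} {x : Euc n}

lemma fderiv_bump_mul_bubble (hx : x ∈ Metric.ball a χ.rIn) :
    fderiv ℝ (fun x => χ x * bubble m a δ x) x = fderiv ℝ (bubble m a δ) x := by
  refine Filter.EventuallyEq.fderiv_eq ?_
  filter_upwards [χ.eventuallyEq_one_of_mem_ball hx] with y hy
  rw [hy, Pi.one_apply, one_mul]

lemma exists_norm_fderiv_bump_mul_bubble_sq_le (χ : ContDiffBump a) (hnm : n = m + 2) :
    ∃ C, 0 ≤ C ∧ ∀ δ, 0 < δ → ∀ x ∈ Metric.closedBall a χ.rOut, x ∉ Metric.ball a χ.rIn →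
      ‖fderiv ℝ (fun x => χ x * bubble m a δ x) x‖ ^ 2 ≤ C := by
  have hχ : ContDiff ℝ 1 χ := χ.contDiff
  obtain ⟨M, hM⟩ := (hχ.continuous_fderiv one_ne_zero).bounded_above_of_compact_support
    (χ.hasCompactSupport.fderiv (𝕜 := ℝ))
  have hr := χ.rIn_pos
  have hM0 : 0 ≤ M := (norm_nonneg _).trans (hM 0)
  refine ⟨2 * (m ^ 2 * (χ.rOut ^ 2 * ((χ.rIn ^ 2) ^ n)⁻¹)) + 2 * (M ^ 2 * ((χ.rIn ^ 2) ^ m)⁻¹),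
    by positivity, fun δ hδ x hx hx' => ?_⟩
  have h1 : ‖x - a‖ ≤ χ.rOut := mem_closedBall_iff_norm.1 hx
  have h2 : χ.rIn ≤ ‖x - a‖ := not_lt.1 fun h => hx' (mem_ball_iff_norm.2 h)
  have h3 : χ.rIn ^ 2 ≤ δ ^ 2 + ‖x - a‖ ^ 2 := by nlinarith
  have hd := (hχ.differentiable one_ne_zero x).hasFDerivAt.mul
    (((contDiff_bubble (m := m) (a := a) (k := 1) hδ).differentiable one_ne_zero x).hasFDerivAt)
  have h4 : ‖fderiv ℝ (fun x => χ x * bubble m a δ x) x‖ ≤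
      ‖fderiv ℝ (bubble m a δ) x‖ + bubble m a δ x * M := by
    rw [show (fun x => χ x * bubble m a δ x) = ⇑χ * bubble m a δ from rfl, hd.fderiv]
    refine (norm_add_le _ _).trans ?_
    rw [norm_smul, norm_smul, Real.norm_of_nonneg χ.nonneg, Real.norm_of_nonneg (bubble_pos hδ x).le]
    refine add_le_add (mul_le_of_le_one_left (norm_nonneg _) χ.le_one) ?_
    exact mul_le_mul_of_nonneg_left (hM x) (bubble_pos hδ x).le
  calc ‖fderiv ℝ (fun x => χ x * bubble m a δ x) x‖ ^ 2
      ≤ (‖fderiv ℝ (bubble m a δ) x‖ + bubble m a δ x * M) ^ 2 := by gcongr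
    _ ≤ 2 * ‖fderiv ℝ (bubble m a δ) x‖ ^ 2 + 2 * (M ^ 2 * bubble m a δ x ^ 2) := by
      nlinarith [sq_nonneg (‖fderiv ℝ (bubble m a δ) x‖ - bubble m a δ x * M)]
    _ ≤ _ := by
      rw [norm_fderiv_bubble_sq hnm hδ, bubble_sq hδ]
      gcongr

/-- The weighted Dirichlet energy of a truncated bubble, up to an error independent of `δ`. -/
lemma exists_setIntegral_energy_le (χ : ContDiffBump a) (hnm : n = m + 2) (hm : 2 ≤ m)
    {Ω : Set (Euc n)} (hΩo : IsOpen Ω) {p : Euc n → ℝ}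
    {p₀ η μ : ℝ} (hp₀ : 0 ≤ p₀) (hp : ∀ x ∈ Ω, 0 ≤ p x) (hη : 0 ≤ η) (hμ : η * m ^ 2 ≤ μ)
    (hpη : ∀ x ∈ Metric.closedBall a χ.rOut, p x ≤ p₀ + η * ‖x - a‖ ^ 2) :
    ∃ C, 0 ≤ C ∧ ∀ δ, 0 < δ →
      ∫ x in Ω, p x * ‖gradient (fun x => χ x * bubble m a δ x) x‖ ^ 2 ≤
        p₀ * (n * (n - 2) * δ ^ 2 * bubbleMass n δ) +
          μ * (∫ x : Euc n in Metric.ball 0 χ.rIn, ((δ ^ 2 + ‖x‖ ^ 2) ^ m)⁻¹) + C := by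
  obtain ⟨C, hC, hCb⟩ := exists_norm_fderiv_bump_mul_bubble_sq_le χ hnm
  have hμ0 : 0 ≤ μ := le_trans (by positivity) hμ
  have hr := χ.rIn_pos
  have hR := χ.rOut_pos
  set C₀ := (p₀ + η * χ.rOut ^ 2) * C with hC₀
  have hC₀0 : 0 ≤ C₀ := by positivity
  refine ⟨C₀ * volume.real (Metric.closedBall (0 : Euc n) χ.rOut), by positivity, fun δ hδ => ?_⟩
  set F₁ : Euc n → ℝ := fun y => p₀ * (m ^ 2 * (‖y‖ ^ 2 * ((δ ^ 2 + ‖y‖ ^ 2) ^ n)⁻¹)) with hF₁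
  set F₂ : Euc n → ℝ := (Metric.ball (0 : Euc n) χ.rIn).indicator
    fun y => μ * ((δ ^ 2 + ‖y‖ ^ 2) ^ m)⁻¹ with hF₂
  set F₃ : Euc n → ℝ := (Metric.closedBall (0 : Euc n) χ.rOut).indicator fun _ => C₀ with hF₃
  have hF₁0 : ∀ y, 0 ≤ F₁ y := fun y => by positivity
  have hF₂0 : ∀ y, 0 ≤ F₂ y := fun y => Set.indicator_nonneg (fun _ _ => by positivity) y
  have hF₃0 : ∀ y, 0 ≤ F₃ y := fun y => Set.indicator_nonneg (fun _ _ => hC₀0) y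
  have hI₁ : Integrable F₁ := by
    have := integrable_sq_mul_inv_add_sq_pow (n := n) hδ (m := n - 1) (by lia)
    rw [show n - 1 + 1 = n by lia] at this
    exact (this.const_mul _).const_mul _
  have hcont : Continuous fun y : Euc n => ((δ ^ 2 + ‖y‖ ^ 2) ^ m)⁻¹ :=
    Continuous.inv₀ (by fun_prop) fun x => by positivity
  have hI₂ : Integrable F₂ := by
    refine IntegrableOn.integrable_indicator ?_ measurableSet_ball
    exact ((continuous_const.mul hcont).continuousOn.integrableOn_compact
      (isCompact_closedBall 0 χ.rIn)).mono_set Metric.ball_subset_closedBall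
  have hI₃ : Integrable F₃ := by
    refine IntegrableOn.integrable_indicator ?_ measurableSet_closedBall
    exact integrableOn_const measure_closedBall_lt_top.ne
  have hI := (hI₁.add hI₂).add hI₃
  have hpt : ∀ x ∈ Ω, p x * ‖gradient (fun x => χ x * bubble m a δ x) x‖ ^ 2 ≤
      (F₁ + F₂ + F₃) (x - a) := by
    intro x hxΩ
    rw [norm_gradient_eq, Pi.add_apply, Pi.add_apply]
    by_cases hx : x ∈ Metric.closedBall a χ.rOut
    · have hxR : ‖x - a‖ ≤ χ.rOut := mem_closedBall_iff_norm.1 hx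
      have hpx := hpη x hx
      by_cases hx' : x ∈ Metric.ball a χ.rIn
      · have hxr : x - a ∈ Metric.ball (0 : Euc n) χ.rIn := by
          rwa [mem_ball_zero_iff, ← mem_ball_iff_norm]
        have e2 : F₂ (x - a) = μ * ((δ ^ 2 + ‖x - a‖ ^ 2) ^ m)⁻¹ := Set.indicator_of_mem hxr _
        rw [fderiv_bump_mul_bubble hx', norm_fderiv_bubble_sq hnm hδ, e2]
        have h5 : ‖x - a‖ ^ 2 * (‖x - a‖ ^ 2 * ((δ ^ 2 + ‖x - a‖ ^ 2) ^ n)⁻¹) ≤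
            ((δ ^ 2 + ‖x - a‖ ^ 2) ^ m)⁻¹ := by
          have hg : 0 < δ ^ 2 + ‖x - a‖ ^ 2 := by positivity
          rw [← mul_assoc, ← div_eq_mul_inv, div_le_iff₀ (by positivity),
            show (δ ^ 2 + ‖x - a‖ ^ 2) ^ n = _ ^ (m + 2) from congrArg _ hnm, pow_add,
            inv_mul_cancel_left₀ (by positivity)]
          nlinarith [sq_nonneg δ, sq_nonneg ‖x - a‖]
        set t := ‖x - a‖ ^ 2 * ((δ ^ 2 + ‖x - a‖ ^ 2) ^ n)⁻¹ with ht
        have ht0 : 0 ≤ t := by positivity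
        have h3 := hF₃0 (x - a)
        calc p x * (m ^ 2 * t) ≤ (p₀ + η * ‖x - a‖ ^ 2) * (m ^ 2 * t) := by gcongr
          _ = p₀ * (m ^ 2 * t) + η * m ^ 2 * (‖x - a‖ ^ 2 * t) := by ring
          _ ≤ p₀ * (m ^ 2 * t) + μ * ((δ ^ 2 + ‖x - a‖ ^ 2) ^ m)⁻¹ := by gcongr
          _ ≤ _ := le_add_of_nonneg_right h3
      · have hxr : x - a ∈ Metric.closedBall (0 : Euc n) χ.rOut := by
          rwa [mem_closedBall_zero_iff]
        have e3 : F₃ (x - a) = C₀ := Set.indicator_of_mem hxr _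
        refine le_trans ?_ (le_add_of_nonneg_left (add_nonneg (hF₁0 _) (hF₂0 _)))
        rw [e3, hC₀]
        refine mul_le_mul (hpx.trans ?_) (hCb δ hδ x hx hx') (by positivity) (by positivity)
        gcongr
    · have h0 : fderiv ℝ (fun x => χ x * bubble m a δ x) x = 0 := by
        refine image_eq_zero_of_notMem_tsupport fun h => hx ?_
        exact χ.tsupport_eq.subset (tsupport_mul_subset_left (tsupport_fderiv_subset ℝ h))
      rw [h0, norm_zero, zero_pow two_ne_zero, mul_zero]
      exact add_nonneg (add_nonneg (hF₁0 _) (hF₂0 _)) (hF₃0 _)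
  have hn2 : (n : ℝ) - 2 = m := by rw [hnm]; push_cast; ring
  calc ∫ x in Ω, p x * ‖gradient (fun x => χ x * bubble m a δ x) x‖ ^ 2
      ≤ ∫ x in Ω, (F₁ + F₂ + F₃) (x - a) := by
        refine integral_mono_of_nonneg ?_ (hI.comp_sub_right a).integrableOn ?_
        · filter_upwards [ae_restrict_mem hΩo.measurableSet] with x hx
          exact mul_nonneg (hp x hx) (sq_nonneg _)
        · filter_upwards [ae_restrict_mem hΩo.measurableSet] with x hx using hpt x hx
    _ ≤ ∫ x, (F₁ + F₂ + F₃) (x - a) :=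
        setIntegral_le_integral (hI.comp_sub_right a) (Eventually.of_forall fun x =>
          add_nonneg (add_nonneg (hF₁0 _) (hF₂0 _)) (hF₃0 _))
    _ = ∫ y, (F₁ + F₂ + F₃) y := integral_sub_right_eq_self _ a
    _ = (∫ y, F₁ y) + (∫ y, F₂ y) + ∫ y, F₃ y := by
        rw [integral_add' (hI₁.add hI₂) hI₃, integral_add' hI₁ hI₂]
    _ = _ := by
        rw [hF₁, hF₂, hF₃, integral_const_mul, integral_const_mul,
          integral_indicator measurableSet_ball, integral_const_mul,
          integral_indicator measurableSet_closedBall, setIntegral_const, smul_eq_mul]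
        have h6 := integral_sq_mul_inv_add_sq_pow (n := n) (by lia) hδ
        rw [hn2] at h6 ⊢
        linear_combination p₀ * m * h6

/-- The critical mass of a truncated bubble, up to an error independent of `δ`. -/
lemma exists_le_setIntegral_abs_rpow (χ : ContDiffBump a) (hm : 0 < m) (hn : 0 < n)
    {Ω : Set (Euc n)} (hΩ : Metric.closedBall a χ.rOut ⊆ Ω) :
    ∃ C, 0 ≤ C ∧ ∀ δ, 0 < δ → bubbleMass n δ - C ≤
      ∫ x in Ω, |χ x * bubble m a δ x| ^ (2 * (n : ℝ) / m) := by
  have hr := χ.rIn_pos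
  set c := min (χ.rIn) 1 with hc
  have hc0 : 0 < c := lt_min hr one_pos
  have hm0 : (0 : ℝ) < m := by exact_mod_cast hm
  have hn0 : (0 : ℝ) < n := by exact_mod_cast hn
  have hI := integrable_inv_add_sq_pow (n := n) hc0 (m := n) (by lia)
  refine ⟨∫ y : Euc n, ((2 : ℝ) ^ n) * ((c ^ 2 + ‖y‖ ^ 2) ^ n)⁻¹,
    integral_nonneg fun y => by positivity, fun δ hδ => ?_⟩
  have hJ := integrable_inv_add_sq_pow (n := n) hδ (m := n) (by lia)
  have hT : IsTest Ω fun x => χ x * bubble m a δ x := isTest_bump_mul_bubble hδ χ hΩ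
  have hq : 0 < 2 * (n : ℝ) / m := by positivity
  rw [hT.setIntegral_abs_rpow hq, sub_le_iff_le_add, bubbleMass,
    ← integral_sub_right_eq_self _ a, ← integral_sub_right_eq_self (fun y : Euc n => 2 ^ n * _) a,
    ← integral_add (integrable_abs_rpow hT.1.continuous hT.2.1 hq)
      ((hI.const_mul _).comp_sub_right a)]
  refine integral_mono (hJ.comp_sub_right a) ((integrable_abs_rpow hT.1.continuous hT.2.1 hq).add
      ((hI.const_mul _).comp_sub_right a)) fun x => ?_
  by_cases hx : x ∈ Metric.ball a χ.rIn
  · refine le_add_of_le_of_nonneg (le_of_eq ?_) (by positivity)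
    rw [χ.one_of_mem_closedBall (Metric.ball_subset_closedBall hx), one_mul,
      abs_of_pos (bubble_pos hδ x), bubble_rpow hm hδ]
  · refine le_add_of_nonneg_of_le (by positivity) ?_
    have h2 : c ≤ ‖x - a‖ := (min_le_left _ _).trans (not_lt.1 fun h => hx (mem_ball_iff_norm.2 h))
    have h3 : c ^ 2 + ‖x - a‖ ^ 2 ≤ 2 * (δ ^ 2 + ‖x - a‖ ^ 2) := by nlinarith [sq_nonneg δ]
    rw [← div_eq_mul_inv, inv_eq_one_div, div_le_div_iff₀ (by positivity) (by positivity), one_mul,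
      ← mul_pow]
    gcongr

lemma le_setIntegral_bump_mul_bubble_sq (χ : ContDiffBump a) (hδ : 0 < δ) {Ω : Set (Euc n)}
    (hΩ : Metric.closedBall a χ.rOut ⊆ Ω) :
    ∫ x : Euc n in Metric.ball 0 χ.rIn, ((δ ^ 2 + ‖x‖ ^ 2) ^ m)⁻¹ ≤
      ∫ x in Ω, (χ x * bubble m a δ x) ^ 2 := by
  have hT : IsTest Ω fun x => χ x * bubble m a δ x := isTest_bump_mul_bubble hδ χ hΩ
  have hc : HasCompactSupport fun x => (χ x * bubble m a δ x) ^ 2 :=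
    hT.2.1.comp_left (g := fun t : ℝ => t ^ 2) (zero_pow two_ne_zero)
  have hI : Integrable fun x => (χ x * bubble m a δ x) ^ 2 :=
    Continuous.integrable_of_hasCompactSupport (by have := hT.1.continuous; fun_prop) hc
  have hsub : Metric.ball a χ.rIn ⊆ Ω :=
    ((Metric.ball_subset_ball χ.rIn_lt_rOut.le).trans Metric.ball_subset_closedBall).trans hΩ
  calc ∫ x : Euc n in Metric.ball 0 χ.rIn, ((δ ^ 2 + ‖x‖ ^ 2) ^ m)⁻¹
      = ∫ x, (Metric.ball (0 : Euc n) χ.rIn).indicator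
          (fun y => ((δ ^ 2 + ‖y‖ ^ 2) ^ m)⁻¹) (x - a) := by
        rw [integral_sub_right_eq_self ((Metric.ball (0 : Euc n) χ.rIn).indicator _) a,
          integral_indicator measurableSet_ball]
    _ = ∫ x in Metric.ball a χ.rIn, (χ x * bubble m a δ x) ^ 2 := by
        rw [← integral_indicator measurableSet_ball]
        refine integral_congr_ae (Eventually.of_forall fun x => ?_)
        by_cases hx : x ∈ Metric.ball a χ.rIn
        · have hx' : x - a ∈ Metric.ball (0 : Euc n) χ.rIn := by
            rwa [mem_ball_zero_iff, ← mem_ball_iff_norm]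
          simp only [Set.indicator_of_mem hx, Set.indicator_of_mem hx',
            χ.one_of_mem_closedBall (Metric.ball_subset_closedBall hx), one_mul, bubble_sq hδ]
        · have hx' : x - a ∉ Metric.ball (0 : Euc n) χ.rIn := by
            rwa [mem_ball_zero_iff, ← mem_ball_iff_norm]
          simp only [Set.indicator_of_notMem hx, Set.indicator_of_notMem hx']
    _ ≤ ∫ x in Ω, (χ x * bubble m a δ x) ^ 2 :=
        setIntegral_mono_set hI.integrableOn (Eventually.of_forall fun x => sq_nonneg _)
          hsub.eventuallyLE

end cutoff

lemma sub_le_rpow_mul_rpow {I J C s t : ℝ} (hI : 0 < I) (hJ : 0 < J) (hC : 0 ≤ C) (h : J - C ≤ I)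
    (hs : 0 ≤ s) (ht : 0 ≤ t) (hst : s + t = 1) : J - C ≤ J ^ s * I ^ t := by
  have hmin : 0 < min I J := lt_min hI hJ
  calc J - C ≤ min I J := le_min h (by linarith)
    _ = min I J ^ s * min I J ^ t := by rw [← Real.rpow_add hmin, hst, Real.rpow_one]
    _ ≤ J ^ s * I ^ t := mul_le_mul
        (Real.rpow_le_rpow hmin.le (min_le_right _ _) hs)
        (Real.rpow_le_rpow hmin.le (min_le_left _ _) ht) (by positivity) (by positivity)

theorem stmt_6 {n : ℕ} (hn : 4 ≤ n)
    (Ω : Set (Euc n)) (hΩo : IsOpen Ω) (hΩb : Bornology.IsBounded Ω)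
    (a : Euc n) (ha : a ∈ Ω)
    (p : Euc n → ℝ) (hpc : ContinuousOn p (closure Ω))
    (p₀ : ℝ) (hp₀ : 0 < p₀) (hpa : p a = p₀) (hmin : ∀ x ∈ closure Ω, p₀ ≤ p x)
    (k β : ℝ) (hk : 2 < k) (hβ : 0 < β) (hA : CondA p a p₀ k β)
    (q : ℝ) (hq : q = 2 * (n : ℝ) / ((n : ℝ) - 2))
    (lam : ℝ) (hlam : 0 < lam) :
    Slam Ω p q lam < p₀ * SobolevS Ω q := by
  obtain ⟨m, rfl⟩ : ∃ m, n = m + 2 := ⟨n - 2, by lia⟩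
  have hm : 2 ≤ m := by lia
  have hm0 : (0 : ℝ) < m := by exact_mod_cast (by lia : 0 < m)
  have hmn : ((m + 2 : ℕ) : ℝ) - 2 = m := by push_cast; ring
  have hη : 0 < lam / (2 * m ^ 2) := by positivity
  obtain ⟨r, hr, hrΩ⟩ := Metric.nhds_basis_closedBall.mem_iff.1
    (inter_mem (hΩo.mem_nhds ha) (hA.exists_le_add_sq hpa hk hη))
  let χ : ContDiffBump a := ⟨r / 2, r, by positivity, by linarith⟩
  have hχΩ : Metric.closedBall a χ.rOut ⊆ Ω := fun x hx => (hrΩ hx).1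
  obtain ⟨C, hC, hE⟩ := exists_setIntegral_energy_le χ rfl hm hΩo hp₀.le
    (fun x hx => hp₀.le.trans (hmin x (subset_closure hx))) hη.le
    (show lam / (2 * m ^ 2) * m ^ 2 ≤ lam / 2 by field_simp; rfl) fun x hx => (hrΩ hx).2
  obtain ⟨C', hC', hM⟩ := exists_le_setIntegral_abs_rpow (m := m) χ (by lia) (by lia) hχΩ
  obtain ⟨δ, hδ, hδ1, hW⟩ := exists_lt_setIntegral_inv_add_sq_pow (n := m + 2) rfl hm χ.rIn_pos
    ((C + p₀ * ((m + 2 : ℕ) * m * C')) * 2 / lam)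
  have hT : IsTest Ω fun x => χ x * bubble m a δ x := isTest_bump_mul_bubble hδ χ hχΩ
  have hS := le_sobolevS hn ⟨_, hT⟩ hq hδ
  have hJ : 0 < bubbleMass (m + 2) δ := bubbleMass_pos (by lia) hδ
  have hL := le_setIntegral_bump_mul_bubble_sq (m := m) χ hδ hχΩ
  specialize hE δ hδ
  specialize hM δ hδ
  rw [hmn] at hq hE hS
  have hq0 : 0 < q := by rw [hq]; positivity
  have hq2 : 2 / q = m / (m + 2 : ℕ) := by rw [hq]; field_simp
  rw [← hq] at hM
  set J := bubbleMass (m + 2) δ with hJdef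
  set W := ∫ x : Euc (m + 2) in Metric.ball 0 χ.rIn, ((δ ^ 2 + ‖x‖ ^ 2) ^ m)⁻¹ with hWdef
  have hI := hT.integral_abs_rpow_pos hq0
  rw [← hT.setIntegral_abs_rpow hq0] at hI
  have hJI := sub_le_rpow_mul_rpow (s := 2 / (m + 2 : ℕ)) (t := m / (m + 2 : ℕ)) hI hJ hC' hM
    (by positivity) (by positivity) (by rw [← add_div]; push_cast; field_simp; ring)
  rw [div_lt_iff₀ hlam] at hW
  set I := ∫ x in Ω, |χ x * bubble m a δ x| ^ q with hIdef
  have hIpos : 0 < I ^ (2 / q) := Real.rpow_pos_of_pos hI _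
  rw [← hq2] at hJI
  set Sδ := (m + 2 : ℕ) * m * δ ^ 2 * J ^ (2 / ((m + 2 : ℕ) : ℝ)) with hSδ
  have hSδ0 : 0 < Sδ := by positivity
  refine lt_of_lt_of_le ?_ (mul_le_mul_of_nonneg_left hS hp₀.le)
  by_cases hbdd : BddBelow {r : ℝ | ∃ u : Euc (m + 2) → ℝ, IsTest Ω u ∧
    r = ((∫ x in Ω, p x * ‖gradient u x‖ ^ 2) - lam * ∫ x in Ω, (u x) ^ 2) /
        (∫ x in Ω, |u x| ^ q) ^ (2 / q)}
  · refine (csInf_le hbdd ⟨_, hT, rfl⟩).trans_lt ?_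
    rw [div_lt_iff₀ hIpos]
    have h1 : p₀ * ((m + 2 : ℕ) * m * δ ^ 2 * (J - C')) ≤ p₀ * Sδ * I ^ (2 / q) := by
      calc p₀ * ((m + 2 : ℕ) * m * δ ^ 2 * (J - C'))
          ≤ p₀ * ((m + 2 : ℕ) * m * δ ^ 2 * (J ^ (2 / ((m + 2 : ℕ) : ℝ)) * I ^ (2 / q))) := by
            gcongr
        _ = _ := by rw [hSδ]; ring
    have h2 : p₀ * ((m + 2 : ℕ) * m * δ ^ 2 * C') ≤ p₀ * ((m + 2 : ℕ) * m * 1 * C') := by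
      have : δ ^ 2 ≤ 1 := pow_le_one₀ hδ.le hδ1
      gcongr
    have h3 := mul_le_mul_of_nonneg_left hL hlam.le
    nlinarith
  · rw [Slam, Real.sInf_of_not_bddBelow hbdd]
    positivity
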